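/- arXiv:1210.6330 — 8 statements merged into one kernel-verified Lean document; each statement's English description precedes it below -/
import Mathlib

section
/- Let Q : ℝ^m → M_m(ℝ) be a C¹ matrix field. Then −(b·∇_y)Q − ᵗ(∂_yb) Q − Q (∂_yb) vanishes identically on ℝ^m if and only if Q(Y(s;y)) = ᵗ(∂_yY(s;y))⁻¹ Q(y) (∂_yY(s;y))⁻¹ for all s ∈ ℝ and all y ∈ ℝ^m. -/
open MeasureTheory Matrix

open Filter Topology Set in
lemma aux_gronwall {E : Type*} [NormedAddCommGroup E] [NormedSpace ℝ E]
    (f f' : ℝ → E) (hf : ∀ t, HasDerivAt f (f' t) t) (δ K ε T : ℝ)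
    (hδ : ‖f 0‖ ≤ δ) (hK : 0 ≤ K) (hε : 0 ≤ ε)
    (hb : ∀ t, |t| ≤ T → ‖f' t‖ ≤ K * ‖f t‖ + ε) (t : ℝ) (ht : |t| ≤ T) :
    ‖f t‖ ≤ gronwallBound δ K ε T := by
  have hδ0 : 0 ≤ δ := (norm_nonneg _).trans hδ
  have pos : ∀ (g g' : ℝ → E), (∀ t, HasDerivAt g (g' t) t) → ‖g 0‖ ≤ δ →
      (∀ t, |t| ≤ T → ‖g' t‖ ≤ K * ‖g t‖ + ε) → ∀ t, 0 ≤ t → t ≤ T →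
      ‖g t‖ ≤ gronwallBound δ K ε T := by
    intro g g' hg h0 hb t h0t htT
    have := norm_le_gronwallBound_of_norm_deriv_right_le (f := g) (f' := g') (δ := δ) (K := K)
      (ε := ε) (a := 0) (b := T) (fun x _ => (hg x).continuousAt.continuousWithinAt)
      (fun x _ => (hg x).hasDerivWithinAt) h0
      (fun x hx => hb x (by rw [abs_of_nonneg hx.1]; exact hx.2.le)) t ⟨h0t, htT⟩
    refine this.trans (gronwallBound_mono hδ0 hε hK (by linarith))
  rcases le_total 0 t with h | h
  · exact pos f f' hf hδ hb t h ((le_abs_self t).trans ht)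
  · have := pos (fun s => f (-s)) (fun s => -f' (-s)) (fun s => by
        have h1 := (hf (-s)).scomp s (hasDerivAt_neg s)
        simpa [Function.comp_def] using h1) (by simpa using hδ)
      (fun s hs => by simpa using hb (-s) (by simpa using hs)) (-t) (by linarith)
      ((neg_le_abs t).trans ht)
    simpa using this

open Filter Topology Set in
lemma aux_variational {E : Type*} [NormedAddCommGroup E] [NormedSpace ℝ E] [FiniteDimensional ℝ E]
    (b : E → E) (hb : ContDiff ℝ 1 b) (C : ℝ) (hC : 0 < C)
    (hgrow : ∀ y, ‖b y‖ ≤ C * (1 + ‖y‖)) (Y : ℝ → E → E)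
    (hY0 : ∀ y, Y 0 y = y)
    (hYd : ∀ (s : ℝ) (y : E), HasDerivAt (fun t => Y t y) (b (Y s y)) s)
    (hYs : ∀ s : ℝ, ContDiff ℝ 1 (Y s)) (y v : E) (s : ℝ) :
    HasDerivAt (fun t => fderiv ℝ (Y t) y v) (fderiv ℝ b (Y s y) (fderiv ℝ (Y s) y v)) s := by
  have : ProperSpace E := FiniteDimensional.proper ℝ E
  have hYc : ∀ z, Continuous fun t => Y t z := fun z =>
    continuous_iff_continuousAt.2 fun t => (hYd t z).continuousAt
  set F : ℝ → ℝ → E := fun c t => c • (b (Y t (y + c⁻¹ • v)) - b (Y t y)) with hF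
  set f : ℝ → E := fun t => fderiv ℝ b (Y t y) (fderiv ℝ (Y t) y v) with hf
  have hFc : ∀ c, Continuous (F c) := fun c => by
    have h1 := hb.continuous.comp (hYc (y + c⁻¹ • v))
    have h2 := hb.continuous.comp (hYc y)
    exact (h1.sub h2).const_smul c
  have hlim : ∀ t, Tendsto (fun c => F c t) atTop (𝓝 (f t)) := fun t => by
    have h1 : HasFDerivAt (Y t) (fderiv ℝ (Y t) y) y :=
      ((hYs t).differentiable one_ne_zero y).hasFDerivAt
    have h2 : HasFDerivAt b (fderiv ℝ b (Y t y)) (Y t y) :=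
      (hb.differentiable one_ne_zero _).hasFDerivAt
    exact (h2.comp y h1).lim_real v
  -- bound
  have hbound : ∀ T : ℝ, ∃ M : ℝ, ∀ c ≥ 1, ∀ t, |t| ≤ T → ‖F c t‖ ≤ M := by
    intro T
    set R := gronwallBound (‖y‖ + ‖v‖) C C T
    have hR : ∀ z, ‖z‖ ≤ ‖y‖ + ‖v‖ → ∀ t, |t| ≤ T → ‖Y t z‖ ≤ R := fun z hz =>
      aux_gronwall (fun t => Y t z) (fun t => b (Y t z)) (fun t => hYd t z) _ C C T
        (by simpa [hY0] using hz) hC.le hC.le (fun t _ => by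
          have := hgrow (Y t z); linarith)
    obtain ⟨K, hK⟩ := (hb.contDiffOn (s := Metric.closedBall (0:E) R)).exists_lipschitzOnWith
      one_ne_zero (convex_closedBall 0 R) (isCompact_closedBall 0 R)
    have hL : ∀ z w, ‖z‖ ≤ ‖y‖ + ‖v‖ → ‖w‖ ≤ ‖y‖ + ‖v‖ → ∀ t, |t| ≤ T →
        ‖b (Y t z) - b (Y t w)‖ ≤ K * ‖Y t z - Y t w‖ := fun z w hz hw t ht => by
      have := hK.dist_le_mul (Y t z) (by simpa using hR z hz t ht) (Y t w)
        (by simpa using hR w hw t ht)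
      simpa [dist_eq_norm] using this
    refine ⟨K * (‖v‖ * Real.exp (K * T)), fun c hc t ht => ?_⟩
    have hc0 : 0 < c := by linarith
    have hy : ‖y‖ ≤ ‖y‖ + ‖v‖ := by linarith [norm_nonneg v]
    have hz : ‖y + c⁻¹ • v‖ ≤ ‖y‖ + ‖v‖ := by
      refine (norm_add_le _ _).trans ?_
      rw [norm_smul, Real.norm_of_nonneg (by positivity)]
      have : c⁻¹ ≤ 1 := inv_le_one_of_one_le₀ hc
      nlinarith [norm_nonneg v]
    have h1 := aux_gronwall (fun t => Y t (y + c⁻¹ • v) - Y t y)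
      (fun t => b (Y t (y + c⁻¹ • v)) - b (Y t y)) (fun t => (hYd t _).sub (hYd t _))
      (c⁻¹ * ‖v‖) K 0 T (by simp [hY0, norm_smul, abs_of_pos hc0]) K.2 le_rfl
      (fun t ht => by simpa using hL _ _ hz hy t ht) t ht
    rw [gronwallBound_ε0] at h1
    have h2 := hL _ _ hz hy t ht
    simp only [hF, norm_smul, Real.norm_of_nonneg hc0.le]
    calc c * ‖b (Y t (y + c⁻¹ • v)) - b (Y t y)‖
        ≤ c * (K * (c⁻¹ * ‖v‖ * Real.exp (K * T))) := by
          refine mul_le_mul_of_nonneg_left (h2.trans ?_) hc0.le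
          exact mul_le_mul_of_nonneg_left h1 K.2
      _ = K * (‖v‖ * Real.exp (K * T)) := by field_simp
  have hu : ∀ a t : ℝ, t ∈ Set.uIoc 0 a → |t| ≤ |a| := fun a t ht => by
    rcases le_total 0 a with h | h
    · rw [uIoc_of_le h] at ht
      rw [abs_of_nonneg h, abs_of_nonneg ht.1.le]; exact ht.2
    · rw [uIoc_of_ge h] at ht
      rw [abs_of_nonpos h, abs_of_nonpos ht.2]; linarith [ht.1]
  have hmeas : StronglyMeasurable f :=
    stronglyMeasurable_of_tendsto atTop (fun c => (hFc c).stronglyMeasurable)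
      (tendsto_pi_nhds.2 hlim)
  have hint0 : ∀ a, IntervalIntegrable f volume 0 a := fun a => by
    obtain ⟨M, hM⟩ := hbound |a|
    refine (intervalIntegrable_const (c := M)).mono_fun hmeas.aestronglyMeasurable ?_
    refine (ae_restrict_iff' measurableSet_uIoc).2 (.of_forall fun t ht => ?_)
    refine le_trans ?_ (le_abs_self M)
    exact le_of_tendsto (hlim t).norm
      ((eventually_ge_atTop 1).mono fun c hc => hM c hc t (hu a t ht))
  have hint : ∀ a a', IntervalIntegrable f volume a a' := fun a a' =>
    (hint0 a).symm.trans (hint0 a')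
  have hid : ∀ a, fderiv ℝ (Y a) y v = v + ∫ t in (0:ℝ)..a, f t := fun a => by
    obtain ⟨M, hM⟩ := hbound |a|
    have h1 : Tendsto (fun c => ∫ t in (0:ℝ)..a, F c t) atTop (𝓝 (∫ t in (0:ℝ)..a, f t)) :=
      intervalIntegral.tendsto_integral_filter_of_dominated_convergence (fun _ => M)
        (.of_forall fun c => (hFc c).aestronglyMeasurable)
        ((eventually_ge_atTop 1).mono fun c hc => .of_forall fun t ht => hM c hc t (hu a t ht))
        intervalIntegrable_const (.of_forall fun t _ => hlim t)
    have h2 : Tendsto (fun c : ℝ => c • (Y a (y + c⁻¹ • v) - Y a y)) atTop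
        (𝓝 (fderiv ℝ (Y a) y v)) :=
      ((hYs a).differentiable one_ne_zero y).hasFDerivAt.lim_real v
    refine tendsto_nhds_unique h2 ((tendsto_const_nhds.add h1).congr' ?_)
    filter_upwards [eventually_ge_atTop 1] with c hc
    have hc0 : c ≠ 0 := by linarith
    have h3 : ∫ t in (0:ℝ)..a, F c t = (fun t => c • (Y t (y + c⁻¹ • v) - Y t y)) a
        - (fun t => c • (Y t (y + c⁻¹ • v) - Y t y)) 0 :=
      intervalIntegral.integral_eq_sub_of_hasDerivAt
        (fun t _ => ((hYd t _).sub (hYd t _)).const_smul c) ((hFc c).intervalIntegrable _ _)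
    rw [h3]
    simp [hY0, smul_smul, hc0]
  have hJc : Continuous fun a => fderiv ℝ (Y a) y v := by
    simp_rw [hid]
    exact continuous_const.add (intervalIntegral.continuous_primitive hint 0)
  have hfc : Continuous f :=
    ((hb.continuous_fderiv one_ne_zero).comp (hYc y)).clm_apply hJc
  have h := (hfc.integral_hasStrictDerivAt 0 s).hasDerivAt.const_add v
  have he : (fun t => fderiv ℝ (Y t) y v) = fun a => v + ∫ t in (0:ℝ)..a, f t := funext hid
  rw [he]
  exact h

lemma aux_mul {m : ℕ} (M N : ℝ → Matrix (Fin m) (Fin m) ℝ) (M' N' : Matrix (Fin m) (Fin m) ℝ)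
    (s : ℝ) (hM : ∀ i j, HasDerivAt (fun t => M t i j) (M' i j) s)
    (hN : ∀ i j, HasDerivAt (fun t => N t i j) (N' i j) s) (i j : Fin m) :
    HasDerivAt (fun t => (M t * N t) i j) ((M' * N s + M s * N') i j) s := by
  simp only [Matrix.mul_apply, Matrix.add_apply, ← Finset.sum_add_distrib]
  exact HasDerivAt.fun_sum fun k _ => (hM i k).mul (hN k j)

lemma aux_jac {m : ℕ} (g : (Fin m → ℝ) → (Fin m → ℝ)) (y : Fin m → ℝ)
    (hg : DifferentiableAt ℝ g y) (i : Fin m) (v : Fin m → ℝ) :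
    fderiv ℝ (fun z => g z i) y v = fderiv ℝ g y v i := by
  have := (hasFDerivAt_pi'.1 hg.hasFDerivAt i).fderiv
  rw [this]; rfl

lemma aux_expand {m : ℕ} (g : (Fin m → ℝ) → (Fin m → ℝ)) (y : Fin m → ℝ)
    (hg : DifferentiableAt ℝ g y) (i : Fin m) (v : Fin m → ℝ) :
    fderiv ℝ g y v i = ∑ k, fderiv ℝ (fun z => g z i) y (Pi.single k (1:ℝ)) * v k := by
  rw [← aux_jac g y hg]
  conv_lhs => rw [pi_eq_sum_univ' v]
  simp [map_sum, mul_comm]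

/-- Let `b` be a `C¹` vector field with linear growth and global flow
`Y`, each Jacobian `∂_y Y(s;y)` being invertible.  For a `C¹` matrix field `Q`, the
adjoint bracket `−(b·∇_y)Q − ᵗ(∂_y b) Q − Q (∂_y b)` vanishes identically iff
`Q(Y(s;y)) = ᵗ(∂_y Y(s;y))⁻¹ Q(y) (∂_y Y(s;y))⁻¹` for all `s, y`. -/
theorem adjoint_matrix_field_invariance_iff_transported
    (m : ℕ) (hm : 1 ≤ m)
    (b : (Fin m → ℝ) → (Fin m → ℝ)) (hb : ContDiff ℝ 1 b)
    (C : ℝ) (hC : 0 < C) (hgrow : ∀ y, ‖b y‖ ≤ C * (1 + ‖y‖))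
    (Y : ℝ → (Fin m → ℝ) → (Fin m → ℝ))
    (hY0 : ∀ y, Y 0 y = y)
    (hYd : ∀ (s : ℝ) (y : Fin m → ℝ), HasDerivAt (fun t => Y t y) (b (Y s y)) s)
    (hYs : ∀ s : ℝ, ContDiff ℝ 1 (Y s))
    (hYinv : ∀ (s : ℝ) (y : Fin m → ℝ),
      IsUnit ((Matrix.of fun i j => fderiv ℝ (fun z => Y s z i) y (Pi.single j (1:ℝ)) :
        Matrix (Fin m) (Fin m) ℝ)).det)
    (Q : (Fin m → ℝ) → Matrix (Fin m) (Fin m) ℝ)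
    (hQ : ∀ i j, ContDiff ℝ 1 (fun y => Q y i j)) :
    (∀ y, - (Matrix.of fun i j => fderiv ℝ (fun z => Q z i j) y (b y))
        - ((Matrix.of fun i j => fderiv ℝ (fun z => b z i) y (Pi.single j (1:ℝ)))ᵀ) * Q y
        - Q y * (Matrix.of fun i j => fderiv ℝ (fun z => b z i) y (Pi.single j (1:ℝ)))
        = 0) ↔
    (∀ (s : ℝ) (y : Fin m → ℝ),
      Q (Y s y)
        = (((Matrix.of fun i j => fderiv ℝ (fun z => Y s z i) y (Pi.single j (1:ℝ)) :
              Matrix (Fin m) (Fin m) ℝ))ᵀ)⁻¹ * Q y *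
          ((Matrix.of fun i j => fderiv ℝ (fun z => Y s z i) y (Pi.single j (1:ℝ)) :
              Matrix (Fin m) (Fin m) ℝ))⁻¹) := by
  set J : ℝ → (Fin m → ℝ) → Matrix (Fin m) (Fin m) ℝ := fun s y =>
    Matrix.of fun i j => fderiv ℝ (fun z => Y s z i) y (Pi.single j (1:ℝ)) with hJ
  set A : (Fin m → ℝ) → Matrix (Fin m) (Fin m) ℝ := fun y =>
    Matrix.of fun i j => fderiv ℝ (fun z => b z i) y (Pi.single j (1:ℝ)) with hA
  set D : (Fin m → ℝ) → Matrix (Fin m) (Fin m) ℝ := fun y =>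
    Matrix.of fun i j => fderiv ℝ (fun z => Q z i j) y (b y) with hD
  change (∀ y, - D y - (A y)ᵀ * Q y - Q y * A y = 0) ↔
    ∀ s y, Q (Y s y) = ((J s y)ᵀ)⁻¹ * Q y * (J s y)⁻¹
  have hYdiff : ∀ s, Differentiable ℝ (Y s) := fun s => (hYs s).differentiable one_ne_zero
  have hbdiff : Differentiable ℝ b := hb.differentiable one_ne_zero
  have hu : ∀ s y, IsUnit (J s y).det := hYinv
  have hJd : ∀ s y i j, HasDerivAt (fun t => J t y i j) ((A (Y s y) * J s y) i j) s := by
    intro s y i j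
    have h := hasDerivAt_pi.1
      (aux_variational b hb C hC hgrow Y hY0 hYd hYs y (Pi.single j 1) s) i
    rw [aux_expand b _ (hbdiff _)] at h
    simp only [hJ, hA, Matrix.mul_apply, Matrix.of_apply, aux_jac _ _ (hYdiff _ _)]
    exact h
  have hQd : ∀ s y i j, HasDerivAt (fun t => Q (Y t y) i j) (D (Y s y) i j) s := by
    intro s y i j
    exact (((hQ i j).differentiable one_ne_zero (Y s y)).hasFDerivAt).comp_hasDerivAt s (hYd s y)
  have hP : ∀ s y i j, HasDerivAt (fun t => ((J t y)ᵀ * Q (Y t y) * J t y) i j)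
      (((J s y)ᵀ * (D (Y s y) + (A (Y s y))ᵀ * Q (Y s y) + Q (Y s y) * A (Y s y)) * J s y) i j)
      s := by
    intro s y i j
    have h := aux_mul (fun t => (J t y)ᵀ * Q (Y t y)) (fun t => J t y) _ _ s
      (aux_mul (fun t => (J t y)ᵀ) (fun t => Q (Y t y)) (A (Y s y) * J s y)ᵀ (D (Y s y)) s
        (fun i j => hJd s y j i) (hQd s y)) (hJd s y) i j
    convert h using 2
    simp only [Matrix.transpose_mul]
    noncomm_ring
  have hJ0 : ∀ y, J 0 y = 1 := by
    intro y
    have h0 : Y 0 = id := funext hY0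
    ext i j
    simp only [hJ, Matrix.of_apply]
    rw [aux_jac _ _ (hYdiff _ _), h0]
    simp [Matrix.one_apply, Pi.single_apply]
  have hneg : ∀ y, (- D y - (A y)ᵀ * Q y - Q y * A y = 0) ↔
      D y + (A y)ᵀ * Q y + Q y * A y = 0 := by
    intro y
    rw [← neg_eq_zero]
    have : -(- D y - (A y)ᵀ * Q y - Q y * A y) = D y + (A y)ᵀ * Q y + Q y * A y := by abel
    rw [this]
  simp only [hneg]
  have hequiv : ∀ s y, (Q (Y s y) = ((J s y)ᵀ)⁻¹ * Q y * (J s y)⁻¹) ↔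
      (J s y)ᵀ * Q (Y s y) * J s y = Q y := by
    intro s y
    have h1 := hu s y
    have h2 : IsUnit ((J s y)ᵀ).det := by rwa [Matrix.det_transpose]
    constructor
    · intro h
      rw [h, Matrix.mul_assoc, Matrix.mul_assoc, Matrix.mul_assoc, Matrix.nonsing_inv_mul _ h1,
        Matrix.mul_one, ← Matrix.mul_assoc, Matrix.mul_nonsing_inv _ h2, Matrix.one_mul]
    · intro h
      rw [← h, Matrix.mul_assoc, Matrix.mul_assoc, Matrix.mul_assoc, Matrix.mul_nonsing_inv _ h1,
        Matrix.mul_one, ← Matrix.mul_assoc, Matrix.nonsing_inv_mul _ h2, Matrix.one_mul]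
  simp only [hequiv]
  constructor
  · intro h s y
    ext i j
    have hc := is_const_of_deriv_eq_zero (f := fun t => ((J t y)ᵀ * Q (Y t y) * J t y) i j)
      (fun t => (hP t y i j).differentiableAt)
      (fun t => by rw [(hP t y i j).deriv, h]; simp) s 0
    simpa [hJ0, hY0] using hc
  · intro h y
    ext i j
    have h1 := hP 0 y i j
    simp only [h] at h1
    have h2 := h1.unique (hasDerivAt_const _ _)
    simpa [hJ0, hY0] using h2
end

section
/- Let A : ℝ^m → M_m(ℝ) be a C¹ matrix field such that [b,A] := (b·∇_y)A − (∂_yb) A − A ᵗ(∂_yb) vanishes identically. Suppose u ∈ L²(ℝ^m) is such that there exists w ∈ L²(ℝ^m) with ∫_{ℝ^m} u div_y(ᵗA ∇_y φ) dy = ∫_{ℝ^m} w φ dy for every φ ∈ C²_c(ℝ^m) (i.e. div_y(A∇_y u) = w in the sense of distributions). Then ∫_{ℝ^m} ⟨u⟩ div_y(ᵗA ∇_y φ) dy = ∫_{ℝ^m} ⟨w⟩ φ dy for every φ ∈ C²_c(ℝ^m); that is, div_y(A ∇_y ⟨u⟩) = ⟨div_y(A ∇_y u)⟩ in the sense of distributions.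 -/
open MeasureTheory Matrix

section P1
open Set

theorem aux_linODE {𝔸 : Type*} [NormedRing 𝔸] [NormedAlgebra ℝ 𝔸] [CompleteSpace 𝔸]
    (B : ℝ → 𝔸) (hB : Continuous B) (β : ℝ) (hβ : ∀ t, ‖B t‖ ≤ β) :
    ∃ J : ℝ → 𝔸, J 0 = 1 ∧ ∀ t, HasDerivAt J (B t * J t) t := by
  have hβ0 : 0 ≤ β := (norm_nonneg _).trans (hβ 0)
  let g : ℕ → ℝ → 𝔸 := fun n => Nat.rec (fun _ => 1) (fun _ f t => ∫ τ in (0:ℝ)..t, B τ * f τ) n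
  have g0 : g 0 = fun _ => 1 := rfl
  have gs : ∀ n, g (n+1) = fun t => ∫ τ in (0:ℝ)..t, B τ * g n τ := fun n => rfl
  have gc : ∀ n, Continuous (g n) := by
    intro n
    induction n with
    | zero => rw [g0]; exact continuous_const
    | succ n ih =>
      rw [gs]
      exact intervalIntegral.continuous_primitive
        (fun a b => (hB.mul ih).intervalIntegrable a b) 0
  have gd : ∀ n t, HasDerivAt (g (n+1)) (B t * g n t) t := by
    intro n t
    rw [gs]
    exact intervalIntegral.integral_hasDerivAt_right ((hB.mul (gc n)).intervalIntegrable _ _)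
      ((hB.mul (gc n)).stronglyMeasurableAtFilter _ _) (hB.mul (gc n)).continuousAt
  have gb : ∀ n t, ‖g n t‖ ≤ ‖(1:𝔸)‖ * ((β * |t|) ^ n / n.factorial) := by
    intro n
    induction n with
    | zero => intro t; simp [g0]
    | succ n ih =>
      intro t
      rw [gs]
      have h1 : ‖∫ τ in (0:ℝ)..t, B τ * g n τ‖ ≤
          ∫ τ in Set.uIoc (0:ℝ) t, ‖(1:𝔸)‖ * β^(n+1) / n.factorial * |τ - 0| ^ n := by
        rw [intervalIntegral.norm_intervalIntegral_eq]
        apply MeasureTheory.norm_integral_le_of_norm_le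
          (Continuous.integrableOn_uIoc (by fun_prop))
        refine Filter.Eventually.of_forall fun τ => ?_
        calc ‖B τ * g n τ‖ ≤ ‖B τ‖ * ‖g n τ‖ := norm_mul_le _ _
          _ ≤ β * (‖(1:𝔸)‖ * ((β * |τ|) ^ n / n.factorial)) :=
            mul_le_mul (hβ τ) (ih τ) (norm_nonneg _) hβ0
          _ = _ := by rw [sub_zero, mul_pow]; ring
      refine h1.trans (le_of_eq ?_)
      rw [integral_const_mul, integral_pow_abs_sub_uIoc, sub_zero, mul_pow, Nat.factorial_succ]
      push_cast
      field_simp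
  have gsum : ∀ t, Summable (fun n => g n t) := fun t =>
    Summable.of_norm_bounded ((Real.summable_pow_div_factorial (β * |t|)).mul_left _) (fun n => gb n t)
  let g' : ℕ → ℝ → 𝔸 := fun n t => match n with
    | 0 => 0
    | n+1 => B t * g n t
  refine ⟨fun t => ∑' n, g n t, ?_, ?_⟩
  · show ∑' n, g n 0 = 1
    refine (tsum_eq_single 0 ?_).trans rfl
    · intro n hn
      obtain ⟨k, rfl⟩ := Nat.exists_eq_succ_of_ne_zero hn
      simp [gs]
  · intro t
    have key : HasDerivAt (fun z => ∑' n, g n z) (∑' n, g' n t) t := by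
      let T := |t| + 1
      refine hasDerivAt_tsum_of_isPreconnected (t := Ioo (-T) T) (y₀ := t)
        (u := fun n => match n with
          | 0 => 0
          | n+1 => β * (‖(1:𝔸)‖ * ((β * T) ^ n / n.factorial))) ?_ isOpen_Ioo isPreconnected_Ioo ?_ ?_ ?_ (gsum t) ?_
      · rw [← summable_nat_add_iff 1]
        exact ((Real.summable_pow_div_factorial (β * T)).mul_left _).mul_left _
      · intro n y hy
        cases n with
        | zero => rw [g0]; exact hasDerivAt_const _ _
        | succ n => exact gd n y
      · intro n y hy
        cases n with
        | zero => simp [g']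
        | succ n =>
          have hyT : |y| ≤ T := (abs_lt.2 hy).le
          refine (norm_mul_le _ _).trans (mul_le_mul (hβ y) ((gb n y).trans ?_) (norm_nonneg _) hβ0)
          gcongr
      · exact abs_lt.1 (lt_add_one _)
      · exact abs_lt.1 (lt_add_one _)
    have e : ∑' n, g' n t = B t * ∑' n, g n t := by
      rw [tsum_eq_zero_add']
      · show 0 + ∑' n, B t * g n t = _
        rw [zero_add, (gsum t).tsum_mul_left]
      · exact (gsum t).mul_left (B t)
    rw [e] at key
    exact key

theorem aux_contDiff_one {E F : Type*} [NormedAddCommGroup E] [NormedSpace ℝ E]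
    [NormedAddCommGroup F] [NormedSpace ℝ F] (f : E → F)
    (hf : ∀ x, ∃ f' : E →L[ℝ] F, HasStrictFDerivAt f f' x) : ContDiff ℝ 1 f := by
  choose f' hf' using hf
  have hd : ∀ x, HasFDerivAt f (f' x) x := fun x => (hf' x).hasFDerivAt
  rw [contDiff_one_iff_fderiv]
  refine ⟨fun x => (hd x).differentiableAt, ?_⟩
  have : fderiv ℝ f = f' := funext fun x => (hd x).fderiv
  rw [this, continuous_iff_continuousAt]
  intro x
  rw [Metric.continuousAt_iff']
  intro ε hε
  have h := (hasStrictFDerivAt_iff_isLittleO.1 (hf' x)).def (half_pos hε)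
  rw [nhds_prod_eq] at h
  obtain ⟨U, hU, V, hV, hUV⟩ := Filter.mem_prod_iff.1 h
  filter_upwards [interior_mem_nhds.2 (Filter.inter_mem hU hV)] with y hy
  rw [dist_eq_norm]
  refine lt_of_le_of_lt ?_ (half_lt_self hε)
  have hdy : HasFDerivAt (fun z => f z - f' x z) (f' y - f' x) y := (hd y).sub (f' x).hasFDerivAt
  refine hdy.le_of_lip' (half_pos hε).le ?_
  filter_upwards [isOpen_interior.mem_nhds hy] with z hz
  have := @hUV (z, y) ⟨(interior_subset hz).1, (interior_subset hy).2⟩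
  have this : ‖f z - f y - (f' x) (z - y)‖ ≤ ε / 2 * ‖z - y‖ := this
  have e : f z - f' x z - (f y - f' x y) = f z - f y - (f' x) (z - y) := by rw [map_sub]; abel
  rw [e]; exact this

end P1

section P2
open Set

variable {E : Type*} [NormedAddCommGroup E] [NormedSpace ℝ E] [FiniteDimensional ℝ E]

theorem aux_bound (b : E → E) (C : ℝ) (hgrow : ∀ y, ‖b y‖ ≤ C * (1 + ‖y‖))
    (Y : ℝ → E → E) (hY0 : ∀ y, Y 0 y = y)
    (hYd : ∀ (s : ℝ) (y : E), HasDerivAt (fun t => Y t y) (b (Y s y)) s)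
    (R T : ℝ) (hR : 0 ≤ R) (hC : 0 ≤ C) :
    ∃ R' : ℝ, ∀ y, ‖y‖ ≤ R → ∀ t ∈ Icc 0 T, ‖Y t y‖ ≤ R' := by
  refine ⟨gronwallBound R C C T, fun y hy t ht => ?_⟩
  have h := norm_le_gronwallBound_of_norm_deriv_right_le (f := fun t => Y t y)
    (f' := fun t => b (Y t y)) (δ := R) (K := C) (ε := C) (a := 0) (b := T)
    (fun s _ => (hYd s y).continuousAt.continuousWithinAt)
    (fun s _ => (hYd s y).hasDerivWithinAt) (by simpa [hY0] using hy)
    (fun s _ => (hgrow _).trans (by linarith)) t ht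
  rw [sub_zero] at h
  exact h.trans (gronwallBound_mono hR hC hC ht.2)

theorem aux_flow_strict (b : E → E) (hb : ContDiff ℝ 1 b)
    (C : ℝ) (hC : 0 ≤ C) (hgrow : ∀ y, ‖b y‖ ≤ C * (1 + ‖y‖))
    (Y : ℝ → E → E) (hY0 : ∀ y, Y 0 y = y)
    (hYd : ∀ (s : ℝ) (y : E), HasDerivAt (fun t => Y t y) (b (Y s y)) s)
    (T : ℝ) (hT : 0 ≤ T) (y : E) :
    ∃ J : ℝ → E →L[ℝ] E, J 0 = 1 ∧
      (∀ t ∈ Icc 0 T, HasDerivAt J (fderiv ℝ b (Y t y) * J t) t) ∧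
      HasStrictFDerivAt (Y T) (J T) y := by
  have hD : Continuous (fderiv ℝ b) := hb.continuous_fderiv one_ne_zero
  obtain ⟨R', hR'⟩ := aux_bound b C hgrow Y hY0 hYd (‖y‖ + 1) T (by positivity) hC
  have hcpt : IsCompact (Metric.closedBall (0:E) R') := isCompact_closedBall _ _
  obtain ⟨β₀, hβ₀⟩ := (hcpt.image hD).isBounded.exists_norm_le
  set β : ℝ := max β₀ 1 with hβdef
  have hβpos : 0 < β := lt_of_lt_of_le one_pos (le_max_right _ _)
  have hβ : ∀ z ∈ Metric.closedBall (0:E) R', ‖fderiv ℝ b z‖ ≤ β := fun z hz =>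
    (hβ₀ _ (mem_image_of_mem _ hz)).trans (le_max_left _ _)
  have hin : ∀ x ∈ Metric.ball y 1, ∀ t ∈ Icc 0 T, Y t x ∈ Metric.closedBall (0:E) R' := by
    intro x hx t ht
    rw [mem_closedBall_zero_iff]
    refine hR' x ?_ t ht
    have : ‖x‖ ≤ ‖y‖ + ‖x - y‖ := by
      calc ‖x‖ = ‖y + (x - y)‖ := by rw [add_sub_cancel]
        _ ≤ _ := norm_add_le _ _
    rw [mem_ball_iff_norm] at hx
    linarith
  have hlip : LipschitzOnWith β.toNNReal b (Metric.closedBall (0:E) R') := by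
    apply Convex.lipschitzOnWith_of_nnnorm_hasFDerivWithin_le (f' := fderiv ℝ b) (𝕜 := ℝ)
    · intro x _
      exact ((hb.differentiable one_ne_zero) x).hasFDerivAt.hasFDerivWithinAt
    · intro x hx
      rw [← NNReal.coe_le_coe, coe_nnnorm, Real.coe_toNNReal _ hβpos.le]
      exact hβ x hx
    · exact convex_closedBall _ _
  set L : ℝ := Real.exp (β * T) with hL
  have hLpos : 0 < L := Real.exp_pos _
  have hYc : ∀ x, Continuous (fun t => Y t x) := fun x =>
    continuous_iff_continuousAt.2 fun s => (hYd s x).continuousAt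
  have hYlip : ∀ x₁ ∈ Metric.ball y 1, ∀ x₂ ∈ Metric.ball y 1, ∀ t ∈ Icc 0 T,
      ‖Y t x₁ - Y t x₂‖ ≤ L * ‖x₁ - x₂‖ := by
    intro x₁ h₁ x₂ h₂ t ht
    have := dist_le_of_trajectories_ODE_of_mem (v := fun _ => b) (K := β.toNNReal)
      (s := fun _ => Metric.closedBall (0:E) R') (a := 0) (b := T)
      (f := fun t => Y t x₁) (g := fun t => Y t x₂) (δ := dist x₁ x₂)
      (fun _ _ => hlip) (hYc _).continuousOn
      (fun s _ => (hYd s _).hasDerivWithinAt) (fun s hs => hin _ h₁ s ⟨hs.1, hs.2.le⟩)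
      (hYc _).continuousOn
      (fun s _ => (hYd s _).hasDerivWithinAt) (fun s hs => hin _ h₂ s ⟨hs.1, hs.2.le⟩)
      (by simp [hY0]) t ht
    rw [dist_eq_norm, dist_eq_norm, Real.coe_toNNReal _ hβpos.le, sub_zero, mul_comm] at this
    refine this.trans ?_
    have : Real.exp (β * t) ≤ L := Real.exp_le_exp.2 (mul_le_mul_of_nonneg_left ht.2 hβpos.le)
    gcongr
  have hyb : y ∈ Metric.ball y 1 := Metric.mem_ball_self one_pos
  let B : ℝ → E →L[ℝ] E := fun t => fderiv ℝ b (Y (projIcc 0 T hT t) y)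
  have hBc : Continuous B :=
    hD.comp ((hYc y).comp (continuous_subtype_val.comp continuous_projIcc))
  have hBβ : ∀ t, ‖B t‖ ≤ β := fun t => hβ _ (hin y hyb _ (projIcc 0 T hT t).2)
  have hBeq : ∀ t ∈ Icc 0 T, B t = fderiv ℝ b (Y t y) := by
    intro t ht; simp only [B]; rw [projIcc_of_mem hT ht]
  obtain ⟨J, hJ0, hJ⟩ := aux_linODE B hBc β hBβ
  refine ⟨J, hJ0, fun t ht => by rw [← hBeq t ht]; exact hJ t, ?_⟩
  rw [hasStrictFDerivAt_iff_isLittleO]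
  refine Asymptotics.IsLittleO.of_bound fun c hc => ?_
  obtain ⟨ε, hε, hεe⟩ : ∃ ε : ℝ, 0 < ε ∧ ε * L * L / β = c := by
    refine ⟨c * β / (L * L), by positivity, ?_⟩
    field_simp
  obtain ⟨δ, hδ, huc⟩ := Metric.uniformContinuousOn_iff.1
    (hcpt.uniformContinuousOn_of_continuous hD.continuousOn) ε hε
  set r : ℝ := min 1 (δ / L) with hr
  have hrpos : 0 < r := lt_min one_pos (by positivity)
  have hnb : Metric.ball y r ×ˢ Metric.ball y r ∈ nhds (y, y) :=
    prod_mem_nhds (Metric.ball_mem_nhds _ hrpos) (Metric.ball_mem_nhds _ hrpos)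
  filter_upwards [hnb] with p hp
  obtain ⟨x₁, x₂⟩ := p
  obtain ⟨h₁, h₂⟩ := hp
  simp only at h₁ h₂ ⊢
  have hsub : Metric.ball y r ⊆ Metric.ball y 1 := Metric.ball_subset_ball (min_le_left _ _)
  have hnear : ∀ x ∈ Metric.ball y r, ∀ t ∈ Icc 0 T, Y t x ∈ Metric.ball (Y t y) δ ∩ Metric.closedBall 0 R' := by
    intro x hx t ht
    refine ⟨?_, hin x (hsub hx) t ht⟩
    rw [mem_ball_iff_norm]
    refine (hYlip x (hsub hx) y hyb t ht).trans_lt ?_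
    have : ‖x - y‖ < δ / L := lt_of_lt_of_le (mem_ball_iff_norm.1 hx) (min_le_right _ _)
    rw [lt_div_iff₀ hLpos] at this
    linarith
  set e : ℝ → E := fun t => Y t x₁ - Y t x₂ - J t (x₁ - x₂) with he
  have hed : ∀ t, HasDerivAt e (b (Y t x₁) - b (Y t x₂) - (B t * J t) (x₁ - x₂)) t := by
    intro t
    refine ((hYd t x₁).sub (hYd t x₂)).sub ?_
    simpa using (hJ t).clm_apply (hasDerivAt_const t (x₁ - x₂))
  have hgr := norm_le_gronwallBound_of_norm_deriv_right_le (f := e)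
    (f' := fun t => b (Y t x₁) - b (Y t x₂) - (B t * J t) (x₁ - x₂)) (δ := 0) (K := β)
    (ε := ε * (L * ‖x₁ - x₂‖)) (a := 0) (b := T)
    (fun t _ => (hed t).continuousAt.continuousWithinAt)
    (fun t _ => (hed t).hasDerivWithinAt) (by simp [he, hY0, hJ0]) ?_ T ⟨hT, le_rfl⟩
  · refine hgr.trans ?_
    rw [gronwallBound_of_K_ne_0 hβpos.ne', ← hεe]
    simp only [zero_mul, zero_add, sub_zero]
    rw [← hL]
    have : ε * (L * ‖x₁ - x₂‖) / β * (L - 1) ≤ ε * (L * ‖x₁ - x₂‖) / β * L := by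
      gcongr; linarith
    refine this.trans (le_of_eq (by ring))
  · intro t ht
    have ht' : t ∈ Icc 0 T := ⟨ht.1, ht.2.le⟩
    have hconv : Convex ℝ (Metric.ball (Y t y) δ ∩ Metric.closedBall 0 R') :=
      (convex_ball _ _).inter (convex_closedBall _ _)
    have hmv := hconv.norm_image_sub_le_of_norm_hasFDerivWithin_le' (f := b) (f' := fderiv ℝ b)
      (φ := fderiv ℝ b (Y t y)) (C := ε) (x := Y t x₂) (y := Y t x₁)
      (fun x _ => ((hb.differentiable one_ne_zero) x).hasFDerivAt.hasFDerivWithinAt)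
      (fun x hx => by
        rw [← dist_eq_norm]
        exact (huc x hx.2 (Y t y) (hin y hyb t ht') hx.1).le)
      (hnear x₂ h₂ t ht') (hnear x₁ h₁ t ht')
    have hsplit : b (Y t x₁) - b (Y t x₂) - (B t * J t) (x₁ - x₂) =
        B t (e t) + (b (Y t x₁) - b (Y t x₂) - fderiv ℝ b (Y t y) (Y t x₁ - Y t x₂)) := by
      rw [hBeq t ht']
      simp only [he, map_sub, mul_apply_eq_comp]
      abel
    rw [hsplit]
    refine (norm_add_le _ _).trans (add_le_add ?_ ?_)
    · exact (ContinuousLinearMap.le_opNorm _ _).trans (by gcongr; exact hBβ t)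
    · refine hmv.trans ?_
      gcongr
      exact hYlip _ (hsub h₁) _ (hsub h₂) t ht'

theorem aux_flow_C1 (b : E → E) (hb : ContDiff ℝ 1 b)
    (C : ℝ) (hC : 0 ≤ C) (hgrow : ∀ y, ‖b y‖ ≤ C * (1 + ‖y‖))
    (Y : ℝ → E → E) (hY0 : ∀ y, Y 0 y = y)
    (hYd : ∀ (s : ℝ) (y : E), HasDerivAt (fun t => Y t y) (b (Y s y)) s)
    (T : ℝ) : ContDiff ℝ 1 (Y T) := by
  rcases le_total 0 T with hT | hT
  · refine aux_contDiff_one _ fun y => ?_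
    obtain ⟨J, -, -, h⟩ := aux_flow_strict b hb C hC hgrow Y hY0 hYd T hT y
    exact ⟨_, h⟩
  · refine aux_contDiff_one _ fun y => ?_
    obtain ⟨J, -, -, h⟩ := aux_flow_strict (fun x => - b x) hb.neg C hC (by simpa using hgrow)
      (fun t => Y (-t)) (by simpa using hY0)
      (fun s y => by simpa using! (hYd (-s) y).scomp s (hasDerivAt_neg s)) (-T) (by linarith) y
    simp only [neg_neg] at h
    exact ⟨_, h⟩

/-- group property -/
theorem aux_group (b : E → E) (hb : ContDiff ℝ 1 b)
    (Y : ℝ → E → E) (hY0 : ∀ y, Y 0 y = y)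
    (hYd : ∀ (s : ℝ) (y : E), HasDerivAt (fun t => Y t y) (b (Y s y)) s)
    (s t : ℝ) (y : E) : Y t (Y s y) = Y (t + s) y := by
  set T := |t| + 1
  have hf : ∀ τ, HasDerivAt (fun τ => Y τ (Y s y)) (b (Y τ (Y s y))) τ := fun τ => hYd τ _
  have hg : ∀ τ, HasDerivAt (fun τ => Y (τ + s) y) (b (Y (τ + s) y)) τ := fun τ =>
    (hYd (τ + s) y).comp_add_const τ s
  have hfc : Continuous (fun τ => Y τ (Y s y)) :=
    continuous_iff_continuousAt.2 fun τ => (hf τ).continuousAt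
  have hgc : Continuous (fun τ => Y (τ + s) y) :=
    continuous_iff_continuousAt.2 fun τ => (hg τ).continuousAt
  obtain ⟨R₁, hR₁⟩ := ((isCompact_Icc (a := -T) (b := T)).image hfc).isBounded.exists_norm_le
  obtain ⟨R₂, hR₂⟩ := ((isCompact_Icc (a := -T) (b := T)).image hgc).isBounded.exists_norm_le
  have hD : Continuous (fderiv ℝ b) := hb.continuous_fderiv one_ne_zero
  obtain ⟨β, hβ⟩ := ((isCompact_closedBall (0:E) (max R₁ R₂)).image hD).isBounded.exists_norm_le
  have hlip : LipschitzOnWith (β.toNNReal) b (Metric.closedBall (0:E) (max R₁ R₂)) := by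
    apply Convex.lipschitzOnWith_of_nnnorm_hasFDerivWithin_le (f' := fderiv ℝ b) (𝕜 := ℝ)
    · intro x _
      exact ((hb.differentiable one_ne_zero) x).hasFDerivAt.hasFDerivWithinAt
    · intro x hx
      rw [← NNReal.coe_le_coe, coe_nnnorm]
      exact (hβ _ (mem_image_of_mem _ hx)).trans (Real.le_coe_toNNReal _)
    · exact convex_closedBall _ _
  have hT : 0 < T := by positivity
  have := ODE_solution_unique_of_mem_Ioo (v := fun _ => b) (K := β.toNNReal)
    (s := fun _ => Metric.closedBall (0:E) (max R₁ R₂)) (a := -T) (b := T) (t₀ := 0)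
    (f := fun τ => Y τ (Y s y)) (g := fun τ => Y (τ + s) y) (fun _ _ => hlip)
    ⟨by linarith, hT⟩
    (fun τ hτ => ⟨hf τ, mem_closedBall_zero_iff.2 ((hR₁ _ (mem_image_of_mem _
      (Ioo_subset_Icc_self hτ))).trans (le_max_left _ _))⟩)
    (fun τ hτ => ⟨hg τ, mem_closedBall_zero_iff.2 ((hR₂ _ (mem_image_of_mem _
      (Ioo_subset_Icc_self hτ))).trans (le_max_right _ _))⟩)
    (by simp [hY0])
  exact this (abs_lt.1 (lt_add_one _))

end P2

section P3
open Set

theorem aux_clm_pi {m : ℕ} {F : Type*} [NormedAddCommGroup F] [NormedSpace ℝ F]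
    (L : (Fin m → ℝ) →L[ℝ] F) (v : Fin m → ℝ) :
    L v = ∑ p, v p • L (Pi.single p (1:ℝ)) := by
  conv_lhs => rw [pi_eq_sum_univ' v]
  rw [map_sum]
  refine Finset.sum_congr rfl fun p _ => ?_
  rw [map_smul]

theorem aux_conj_nonneg {m : ℕ}
    (b : (Fin m → ℝ) → (Fin m → ℝ)) (hb : ContDiff ℝ 1 b)
    (C : ℝ) (hC : 0 ≤ C) (hgrow : ∀ y, ‖b y‖ ≤ C * (1 + ‖y‖))
    (Y : ℝ → (Fin m → ℝ) → (Fin m → ℝ))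
    (hY0 : ∀ y, Y 0 y = y)
    (hYd : ∀ (s : ℝ) (y : Fin m → ℝ), HasDerivAt (fun t => Y t y) (b (Y s y)) s)
    (A : (Fin m → ℝ) → Matrix (Fin m) (Fin m) ℝ)
    (hA : ∀ i j, ContDiff ℝ 1 (fun y => A y i j))
    (hbA : ∀ y i j, fderiv ℝ (fun z => A z i j) y (b y) =
      ∑ k, fderiv ℝ b y (Pi.single k (1:ℝ)) i * A y k j
       + ∑ k, A y i k * fderiv ℝ b y (Pi.single k (1:ℝ)) j)
    (T : ℝ) (hT : 0 ≤ T) (y : Fin m → ℝ) (i j : Fin m) :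
    ∑ k, ∑ l, fderiv ℝ (Y T) y (Pi.single k (1:ℝ)) i * A y k l *
      fderiv ℝ (Y T) y (Pi.single l (1:ℝ)) j = A (Y T y) i j := by
  obtain ⟨J, hJ0, hJ, hs⟩ := aux_flow_strict b hb C hC hgrow Y hY0 hYd T hT y
  rw [hs.hasFDerivAt.fderiv]
  have hD : Continuous (fderiv ℝ b) := hb.continuous_fderiv one_ne_zero
  have hYc : Continuous (fun t => Y t y) :=
    continuous_iff_continuousAt.2 fun s => (hYd s y).continuousAt
  let β : ℝ → Fin m → Fin m → ℝ := fun t i p => fderiv ℝ b (Y t y) (Pi.single p (1:ℝ)) i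
  have hβc : Continuous β := by
    refine continuous_pi fun i => continuous_pi fun p => ?_
    exact (continuous_apply i).comp ((hD.comp hYc).clm_apply continuous_const)
  obtain ⟨β₀, hβ₀⟩ := ((isCompact_Icc (a := (0:ℝ)) (b := T)).image hβc).isBounded.exists_norm_le
  let x : ℝ → Fin m → Fin m → ℝ := fun t i k => J t (Pi.single k (1:ℝ)) i
  have hx : ∀ t ∈ Icc 0 T, ∀ i k, HasDerivAt (fun t => x t i k) (∑ p, β t i p * x t p k) t := by
    intro t ht i k
    have h1 := (hJ t ht).clm_apply (hasDerivAt_const t (Pi.single k (1:ℝ) : Fin m → ℝ))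
    have h2 := (hasDerivAt_pi.1 h1) i
    convert! h2 using 1
    simp only [map_zero, add_zero, mul_apply_eq_comp]
    rw [aux_clm_pi (fderiv ℝ b (Y t y))]
    simp [β, x, mul_comm]
  have hAd : ∀ t i j, HasDerivAt (fun t => A (Y t y) i j)
      (∑ k, β t i k * A (Y t y) k j + ∑ k, A (Y t y) i k * β t j k) t := by
    intro t i j
    have h1 := ((hA i j).differentiable one_ne_zero (Y t y)).hasFDerivAt.comp_hasDerivAt t (hYd t y)
    rw [hbA] at h1
    exact h1
  let M : ℝ → Fin m → Fin m → ℝ := fun t i j =>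
    ∑ k, ∑ l, x t i k * A y k l * x t j l - A (Y t y) i j
  have hM : ∀ t ∈ Icc 0 T, HasDerivAt M
      (fun i j => ∑ p, β t i p * M t p j + ∑ p, M t i p * β t j p) t := by
    intro t ht
    refine hasDerivAt_pi.2 fun i => hasDerivAt_pi.2 fun j => ?_
    have h1 : HasDerivAt (fun t => ∑ k, ∑ l, x t i k * A y k l * x t j l)
      (∑ k, ∑ l, ((∑ p, β t i p * x t p k) * A y k l * x t j l
        + x t i k * A y k l * (∑ p, β t j p * x t p l))) t := by
      refine HasDerivAt.fun_sum fun k _ => HasDerivAt.fun_sum fun l _ => ?_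
      exact ((hx t ht i k).mul_const _).mul (hx t ht j l)
    convert! h1.sub (hAd t i j) using 1
    simp only [M, mul_sub, sub_mul, Finset.sum_sub_distrib, Finset.sum_add_distrib,
      Finset.mul_sum, Finset.sum_mul]
    have e1 : ∑ p, ∑ k, ∑ l, β t i p * (x t p k * A y k l * x t j l) =
        ∑ k, ∑ l, ∑ p, β t i p * x t p k * A y k l * x t j l := by
      rw [Finset.sum_comm]
      refine Finset.sum_congr rfl fun k _ => ?_
      rw [Finset.sum_comm]
      refine Finset.sum_congr rfl fun l _ => Finset.sum_congr rfl fun p _ => by ring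
    have e2 : ∑ p, ∑ k, ∑ l, x t i k * A y k l * x t p l * β t j p =
        ∑ k, ∑ l, ∑ p, x t i k * A y k l * (β t j p * x t p l) := by
      rw [Finset.sum_comm]
      refine Finset.sum_congr rfl fun k _ => ?_
      rw [Finset.sum_comm]
      refine Finset.sum_congr rfl fun l _ => Finset.sum_congr rfl fun p _ => by ring
    rw [e1, e2]; ring
  have hzero := eq_zero_of_abs_deriv_le_mul_abs_self_of_eq_zero_right (f := M)
    (f' := fun t i j => ∑ p, β t i p * M t p j + ∑ p, M t i p * β t j p)
    (K := 2 * m * β₀) (a := 0) (b := T)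
    (fun t ht => (hM t ht).continuousAt.continuousWithinAt)
    (fun t ht => (hM t ⟨ht.1, ht.2.le⟩).hasDerivWithinAt) ?_ ?_ T ⟨hT, le_rfl⟩
  · have := congrFun (congrFun hzero i) j
    simp only [M, Pi.zero_apply] at this
    exact sub_eq_zero.1 this
  · ext i j
    simp [M, x, hJ0, hY0, Pi.single_apply]
  · intro t ht
    have hb' : ‖β t‖ ≤ β₀ := hβ₀ _ (mem_image_of_mem _ ⟨ht.1, ht.2.le⟩)
    have hβ00 : 0 ≤ β₀ := (norm_nonneg _).trans hb'
    have hbe : ∀ i p, |β t i p| ≤ β₀ := fun i p =>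
      ((norm_le_pi_norm (β t i) p).trans (norm_le_pi_norm (β t) i)).trans hb'
    have hMe : ∀ i p, |M t i p| ≤ ‖M t‖ := fun i p =>
      ((norm_le_pi_norm (M t i) p).trans (norm_le_pi_norm (M t) i))
    have hnn : 0 ≤ 2 * m * β₀ * ‖M t‖ := by positivity
    refine (pi_norm_le_iff_of_nonneg hnn).2 fun i => (pi_norm_le_iff_of_nonneg hnn).2 fun j => ?_
    have s1 : |∑ p, β t i p * M t p j| ≤ m * (β₀ * ‖M t‖) := by
      refine (Finset.abs_sum_le_sum_abs _ _).trans ?_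
      refine (Finset.sum_le_card_nsmul _ _ (β₀ * ‖M t‖) fun p _ => ?_).trans (by simp)
      rw [abs_mul]
      exact mul_le_mul (hbe _ _) (hMe _ _) (abs_nonneg _) hβ00
    have s2 : |∑ p, M t i p * β t j p| ≤ m * (β₀ * ‖M t‖) := by
      refine (Finset.abs_sum_le_sum_abs _ _).trans ?_
      refine (Finset.sum_le_card_nsmul _ _ (β₀ * ‖M t‖) fun p _ => ?_).trans (by simp)
      rw [abs_mul, mul_comm]
      exact mul_le_mul (hbe _ _) (hMe _ _) (abs_nonneg _) hβ00
    refine (abs_add_le _ _).trans ?_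
    linarith

theorem aux_conj {m : ℕ}
    (b : (Fin m → ℝ) → (Fin m → ℝ)) (hb : ContDiff ℝ 1 b)
    (C : ℝ) (hC : 0 ≤ C) (hgrow : ∀ y, ‖b y‖ ≤ C * (1 + ‖y‖))
    (Y : ℝ → (Fin m → ℝ) → (Fin m → ℝ))
    (hY0 : ∀ y, Y 0 y = y)
    (hYd : ∀ (s : ℝ) (y : Fin m → ℝ), HasDerivAt (fun t => Y t y) (b (Y s y)) s)
    (A : (Fin m → ℝ) → Matrix (Fin m) (Fin m) ℝ)
    (hA : ∀ i j, ContDiff ℝ 1 (fun y => A y i j))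
    (hbA : ∀ y, (Matrix.of fun i j => fderiv ℝ (fun z => A z i j) y (b y))
        - (Matrix.of fun i j => fderiv ℝ (fun z => b z i) y (Pi.single j (1:ℝ))) * A y
        - A y * ((Matrix.of fun i j => fderiv ℝ (fun z => b z i) y (Pi.single j (1:ℝ)))ᵀ)
        = 0)
    (T : ℝ) (y : Fin m → ℝ) (i j : Fin m) :
    ∑ k, ∑ l, fderiv ℝ (Y T) y (Pi.single k (1:ℝ)) i * A y k l *
      fderiv ℝ (Y T) y (Pi.single l (1:ℝ)) j = A (Y T y) i j := by
  have hbA' : ∀ y i j, fderiv ℝ (fun z => A z i j) y (b y) =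
      ∑ k, fderiv ℝ b y (Pi.single k (1:ℝ)) i * A y k j
       + ∑ k, A y i k * fderiv ℝ b y (Pi.single k (1:ℝ)) j := by
    intro y i j
    have hf : ∀ i v, fderiv ℝ (fun z => b z i) y v = fderiv ℝ b y v i := by
      intro i v
      have := hasFDerivAt_pi'.1 ((hb.differentiable one_ne_zero) y).hasFDerivAt i
      rw [this.fderiv]; rfl
    have h := congrFun (congrFun (hbA y) i) j
    simp only [Matrix.sub_apply, Matrix.of_apply, Matrix.mul_apply, Matrix.transpose_apply, hf,
      Matrix.zero_apply] at h
    linarith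
  rcases le_total 0 T with hT | hT
  · exact aux_conj_nonneg b hb C hC hgrow Y hY0 hYd A hA hbA' T hT y i j
  · have := aux_conj_nonneg (fun x => - b x) hb.neg C hC (by simpa using hgrow)
      (fun t => Y (-t)) (by simpa using hY0)
      (fun s y => by simpa using! (hYd (-s) y).scomp s (hasDerivAt_neg s)) A hA ?_ (-T)
      (by linarith) y i j
    · simpa only [neg_neg] using this
    · intro y i j
      have e : fderiv ℝ (fun x => - b x) y = - fderiv ℝ b y := fderiv_fun_neg
      rw [map_neg, hbA', e]
      simp [Finset.sum_neg_distrib]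
      ring

end P3

section P4
open Set

/-- the formal adjoint operator `div (ᵗA ∇ φ)` -/
noncomputable def auxL {m : ℕ} (A : (Fin m → ℝ) → Matrix (Fin m) (Fin m) ℝ)
    (φ : (Fin m → ℝ) → ℝ) (y : Fin m → ℝ) : ℝ :=
  ∑ i, fderiv ℝ (fun z => ∑ j, A z j i * fderiv ℝ φ z (Pi.single j (1:ℝ))) y (Pi.single i (1:ℝ))

theorem aux_cs_mul_left {E : Type*} [TopologicalSpace E] {f g : E → ℝ} (hg : HasCompactSupport g) :
    HasCompactSupport (fun x => f x * g x) := hg.mul_left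

theorem aux_fderiv_cs {E : Type*} [NormedAddCommGroup E] [NormedSpace ℝ E] {f : E → ℝ}
    (hf : HasCompactSupport f) (v : E) : HasCompactSupport (fun x => fderiv ℝ f x v) :=
  (hf.fderiv ℝ).comp_left (g := fun L : E →L[ℝ] ℝ => L v) (by simp)

theorem aux_fderiv_cont {E : Type*} [NormedAddCommGroup E] [NormedSpace ℝ E] {f : E → ℝ}
    (hf : ContDiff ℝ 1 f) (v : E) : Continuous (fun x => fderiv ℝ f x v) :=
  (hf.continuous_fderiv one_ne_zero).clm_apply continuous_const

theorem aux_flux_C1 {m : ℕ} (A : (Fin m → ℝ) → Matrix (Fin m) (Fin m) ℝ)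
    (hA : ∀ i j, ContDiff ℝ 1 (fun y => A y i j)) (φ : (Fin m → ℝ) → ℝ) (hφ : ContDiff ℝ 2 φ)
    (i : Fin m) :
    ContDiff ℝ 1 (fun z => ∑ j, A z j i * fderiv ℝ φ z (Pi.single j (1:ℝ))) := by
  refine ContDiff.sum fun j _ => (hA j i).mul ?_
  exact (hφ.fderiv_right (m := 1) (by norm_num)).clm_apply contDiff_const

theorem auxL_cont {m : ℕ} (A : (Fin m → ℝ) → Matrix (Fin m) (Fin m) ℝ)
    (hA : ∀ i j, ContDiff ℝ 1 (fun y => A y i j)) (φ : (Fin m → ℝ) → ℝ) (hφ : ContDiff ℝ 2 φ) :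
    Continuous (auxL A φ) := by
  unfold auxL
  exact continuous_finset_sum _ fun i _ => aux_fderiv_cont (aux_flux_C1 A hA φ hφ i) _

theorem aux_flux_cs {m : ℕ} (A : (Fin m → ℝ) → Matrix (Fin m) (Fin m) ℝ)
    (φ : (Fin m → ℝ) → ℝ) (hφc : HasCompactSupport φ) (i : Fin m) :
    HasCompactSupport (fun z => ∑ j, A z j i * fderiv ℝ φ z (Pi.single j (1:ℝ))) := by
  refine hφc.mono' (Function.support_subset_iff'.2 fun x hx => ?_)
  have : fderiv ℝ φ x = 0 := by
    by_contra h
    exact hx (support_fderiv_subset ℝ h)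
  simp [this]

theorem auxL_cs {m : ℕ} (A : (Fin m → ℝ) → Matrix (Fin m) (Fin m) ℝ)
    (φ : (Fin m → ℝ) → ℝ) (hφc : HasCompactSupport φ) :
    HasCompactSupport (auxL A φ) := by
  refine hφc.mono' (Function.support_subset_iff'.2 fun x hx => ?_)
  unfold auxL
  refine Finset.sum_eq_zero fun i _ => ?_
  have : (fun z => ∑ j, A z j i * fderiv ℝ φ z (Pi.single j (1:ℝ))) =ᶠ[nhds x] fun _ => 0 := by
    filter_upwards [(isClosed_tsupport φ).isOpen_compl.mem_nhds hx] with z hz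
    have : fderiv ℝ φ z = 0 := by
      by_contra h
      exact hz (support_fderiv_subset ℝ h)
    simp [this]
  rw [this.fderiv_eq]
  simp

theorem aux_ibp {m : ℕ} (A : (Fin m → ℝ) → Matrix (Fin m) (Fin m) ℝ)
    (hA : ∀ i j, ContDiff ℝ 1 (fun y => A y i j))
    (φ : (Fin m → ℝ) → ℝ) (hφ : ContDiff ℝ 2 φ)
    (ζ : (Fin m → ℝ) → ℝ) (hζ : ContDiff ℝ 1 ζ) (hζc : HasCompactSupport ζ) :
    ∫ y, ∑ i, (∑ j, A y j i * fderiv ℝ φ y (Pi.single j (1:ℝ))) * fderiv ℝ ζ y (Pi.single i (1:ℝ))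
      = - ∫ y, auxL A φ y * ζ y := by
  have hF := aux_flux_C1 A hA φ hφ
  have h1 : ∀ i, Integrable (fun y => (∑ j, A y j i * fderiv ℝ φ y (Pi.single j (1:ℝ))) *
      fderiv ℝ ζ y (Pi.single i (1:ℝ))) volume := fun i =>
    ((hF i).continuous.mul (aux_fderiv_cont hζ _)).integrable_of_hasCompactSupport
      (aux_cs_mul_left (aux_fderiv_cs hζc _))
  have h2 : ∀ i, Integrable (fun y => fderiv ℝ (fun z => ∑ j, A z j i * fderiv ℝ φ z
      (Pi.single j (1:ℝ))) y (Pi.single i (1:ℝ)) * ζ y) volume := fun i =>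
    ((aux_fderiv_cont (hF i) _).mul hζ.continuous).integrable_of_hasCompactSupport
      (aux_cs_mul_left hζc)
  rw [integral_finset_sum _ fun i _ => h1 i]
  have h3 : ∀ y, auxL A φ y * ζ y = ∑ i, fderiv ℝ (fun z => ∑ j, A z j i * fderiv ℝ φ z
      (Pi.single j (1:ℝ))) y (Pi.single i (1:ℝ)) * ζ y := fun y => by
    unfold auxL; rw [Finset.sum_mul]
  rw [integral_congr_ae (Filter.Eventually.of_forall h3)]
  rw [integral_finset_sum _ fun i _ => h2 i, ← Finset.sum_neg_distrib]
  refine Finset.sum_congr rfl fun i _ => ?_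
  exact integral_mul_fderiv_eq_neg_fderiv_mul_of_integrable (h2 i) (h1 i)
    (((hF i).continuous.mul hζ.continuous).integrable_of_hasCompactSupport (aux_cs_mul_left hζc))
    (fun x _ => (hF i).differentiable one_ne_zero x) (fun x _ => hζ.differentiable one_ne_zero x)

theorem aux_sums {m : ℕ} (D a : Matrix (Fin m) (Fin m) ℝ) (P Q : Fin m → ℝ) :
    ∑ i, (∑ j, a j i * ∑ k, D j k * P k) * ∑ l, D i l * Q l =
    ∑ l, (∑ k, (∑ k', ∑ l', D k' k * a k' l' * D l' l) * P k) * Q l := by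
  have h1 : ∑ l, (∑ k, (∑ k', ∑ l', D k' k * a k' l' * D l' l) * P k) * Q l =
      (P ᵥ* (Dᵀ * (a * D))) ⬝ᵥ Q := by
    simp only [dotProduct, vecMul, Matrix.mul_apply, transpose_apply, Finset.mul_sum,
      Finset.sum_mul]
    refine Finset.sum_congr rfl fun l _ => Finset.sum_congr rfl fun k _ =>
      Finset.sum_congr rfl fun _ _ => Finset.sum_congr rfl fun _ _ => by ring
  have h2 : ∑ i, (∑ j, a j i * ∑ k, D j k * P k) * ∑ l, D i l * Q l =
      ((D *ᵥ P) ᵥ* a) ⬝ᵥ (D *ᵥ Q) := by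
    simp only [dotProduct, vecMul, mulVec, Finset.sum_mul, Finset.mul_sum]
    refine Finset.sum_congr rfl fun l _ => Finset.sum_congr rfl fun k _ =>
      Finset.sum_congr rfl fun _ _ => Finset.sum_congr rfl fun _ _ => by ring
  rw [h1, h2, dotProduct_mulVec, ← vecMul_vecMul, ← vecMul_vecMul, vecMul_transpose]

theorem aux_weak {m : ℕ} (A : (Fin m → ℝ) → Matrix (Fin m) (Fin m) ℝ)
    (hA : ∀ i j, ContDiff ℝ 1 (fun y => A y i j))
    (Φ Ψ : (Fin m → ℝ) → (Fin m → ℝ)) (hΦ : ContDiff ℝ 1 Φ) (hΨ : ContDiff ℝ 1 Ψ)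
    (hΦΨ : ∀ y, Φ (Ψ y) = y) (hΨΦ : ∀ y, Ψ (Φ y) = y)
    (hmp : MeasurePreserving Φ (volume : Measure (Fin m → ℝ)) volume)
    (hconj : ∀ y i j, ∑ k, ∑ l, fderiv ℝ Φ y (Pi.single k (1:ℝ)) i * A y k l *
      fderiv ℝ Φ y (Pi.single l (1:ℝ)) j = A (Φ y) i j)
    (φ : (Fin m → ℝ) → ℝ) (hφ : ContDiff ℝ 2 φ)
    (η : (Fin m → ℝ) → ℝ) (hη : ContDiff ℝ 1 η) (hηc : HasCompactSupport η) :
    ∫ y, ∑ i, (∑ j, A y j i * fderiv ℝ (fun z => φ (Φ z)) y (Pi.single j (1:ℝ))) *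
        fderiv ℝ η y (Pi.single i (1:ℝ))
      = - ∫ y, auxL A φ (Φ y) * η y := by
  let e : (Fin m → ℝ) ≃ₜ (Fin m → ℝ) :=
    { toFun := Ψ, invFun := Φ, left_inv := hΦΨ, right_inv := hΨΦ,
      continuous_toFun := hΨ.continuous, continuous_invFun := hΦ.continuous }
  have hζ : ContDiff ℝ 1 (fun y => η (Ψ y)) := hη.comp hΨ
  have hζc : HasCompactSupport (fun y => η (Ψ y)) := hηc.comp_homeomorph e
  have hchange : ∀ F : (Fin m → ℝ) → ℝ, Continuous F → ∫ y, F (Φ y) = ∫ y, F y := by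
    intro F hF
    have := integral_map (μ := volume) hmp.measurable.aemeasurable (f := F) hF.aestronglyMeasurable
    rw [hmp.map_eq] at this
    exact this.symm
  have key := aux_ibp A hA φ hφ _ hζ hζc
  rw [← hchange (fun y => auxL A φ y * η (Ψ y))
    ((auxL_cont A hA φ hφ).mul (hη.continuous.comp hΨ.continuous))] at key
  simp only [hΨΦ] at key
  rw [← key, ← hchange (fun y => ∑ i, (∑ j, A y j i * fderiv ℝ φ y (Pi.single j (1:ℝ))) *
    fderiv ℝ (fun y => η (Ψ y)) y (Pi.single i (1:ℝ)))]
  swap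
  · exact continuous_finset_sum _ fun i _ =>
      (aux_flux_C1 A hA φ hφ i).continuous.mul (aux_fderiv_cont hζ _)
  refine integral_congr_ae (Filter.Eventually.of_forall fun y => ?_)
  have hΦd := (hΦ.differentiable one_ne_zero y).hasFDerivAt
  have d1 : ∀ j, fderiv ℝ (fun z => φ (Φ z)) y (Pi.single j (1:ℝ)) =
      ∑ k, fderiv ℝ Φ y (Pi.single j (1:ℝ)) k * fderiv ℝ φ (Φ y) (Pi.single k (1:ℝ)) := by
    intro j
    have := ((hφ.differentiable two_ne_zero (Φ y)).hasFDerivAt.comp y hΦd).fderiv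
    change fderiv ℝ (φ ∘ Φ) y _ = _
    rw [this, ContinuousLinearMap.comp_apply, aux_clm_pi (fderiv ℝ φ (Φ y))]
    simp
  have d2 : ∀ j, fderiv ℝ η y (Pi.single j (1:ℝ)) =
      ∑ k, fderiv ℝ Φ y (Pi.single j (1:ℝ)) k *
        fderiv ℝ (fun y => η (Ψ y)) (Φ y) (Pi.single k (1:ℝ)) := by
    intro j
    have h := ((hζ.differentiable one_ne_zero (Φ y)).hasFDerivAt.comp y hΦd).fderiv
    have h' : (fun y => η (Ψ y)) ∘ Φ = η := by ext z; simp [hΨΦ]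
    rw [h'] at h
    rw [h, ContinuousLinearMap.comp_apply, aux_clm_pi (fderiv ℝ (fun y => η (Ψ y)) (Φ y))]
    simp
  simp only
  simp_rw [d1, d2, ← hconj y]
  generalize fderiv ℝ Φ y = D
  generalize fderiv ℝ φ (Φ y) = P
  generalize fderiv ℝ (fun y => η (Ψ y)) (Φ y) = Q
  exact aux_sums (fun j k => D (Pi.single j 1) k) (A y) (fun k => P (Pi.single k 1))
    (fun k => Q (Pi.single k 1))

end P4

section P5
open Set

theorem aux_conv_right {m : ℕ} (h r : (Fin m → ℝ) → ℝ) (hh : Continuous h)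
    (hr : ContDiff ℝ 1 r) (hrc : HasCompactSupport r) (x : Fin m → ℝ) :
    DifferentiableAt ℝ (fun x => ∫ y, h y * r (x - y)) x ∧
    ∀ v, fderiv ℝ (fun x => ∫ y, h y * r (x - y)) x v = ∫ y, h y * fderiv ℝ r (x - y) v := by
  have H := hrc.hasFDerivAt_convolution_right (μ := volume) (ContinuousLinearMap.mul ℝ ℝ)
    (hh.locallyIntegrable) hr x
  have H' : HasFDerivAt (fun x => ∫ y, h y * r (x - y)) _ x := H
  refine ⟨H'.differentiableAt, fun v => ?_⟩
  rw [H'.fderiv, convolution_precompR_apply _ hh.locallyIntegrable (hrc.fderiv ℝ)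
    (hr.continuous_fderiv one_ne_zero)]
  rfl

theorem aux_conv_symm {m : ℕ} (h r : (Fin m → ℝ) → ℝ) (x : Fin m → ℝ) :
    ∫ y, h y * r (x - y) = ∫ y, r y * h (x - y) := by
  rw [← integral_sub_left_eq_self _ _ x]
  simp [mul_comm]

theorem aux_conv_left {m : ℕ} (h r : (Fin m → ℝ) → ℝ) (hh : ContDiff ℝ 1 h)
    (hhc : HasCompactSupport h) (hr : Continuous r) (x : Fin m → ℝ) (v : Fin m → ℝ) :
    fderiv ℝ (fun x => ∫ y, h y * r (x - y)) x v = ∫ y, fderiv ℝ h y v * r (x - y) := by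
  simp_rw [aux_conv_symm h r]
  rw [(aux_conv_right r h hr hh hhc x).2 v, aux_conv_symm]

theorem aux_conv_C2 {m : ℕ} (h r : (Fin m → ℝ) → ℝ) (hh : Continuous h)
    (hr : ContDiff ℝ 2 r) (hrc : HasCompactSupport r) :
    ContDiff ℝ 2 (fun x => ∫ y, h y * r (x - y)) :=
  hrc.contDiff_convolution_right (n := 2) (μ := volume) (ContinuousLinearMap.mul ℝ ℝ)
    (hh.locallyIntegrable) hr

theorem aux_shift_cs {m : ℕ} (r : (Fin m → ℝ) → ℝ) 
    (hrc : HasCompactSupport r) (x : Fin m → ℝ) : HasCompactSupport (fun y => r (x - y)) :=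
  hrc.comp_homeomorph (Homeomorph.subLeft x)

theorem aux_auxL_conv {m : ℕ} (A : (Fin m → ℝ) → Matrix (Fin m) (Fin m) ℝ)
    (hA : ∀ i j, ContDiff ℝ 1 (fun y => A y i j))
    (ψ g : (Fin m → ℝ) → ℝ) (hψ : ContDiff ℝ 1 ψ) (hψc : HasCompactSupport ψ) 
    (hweak : ∀ η : (Fin m → ℝ) → ℝ, ContDiff ℝ 1 η → HasCompactSupport η →
      ∫ y, ∑ i, (∑ j, A y j i * fderiv ℝ ψ y (Pi.single j (1:ℝ))) *
        fderiv ℝ η y (Pi.single i (1:ℝ)) = - ∫ y, g y * η y)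
    (r : (Fin m → ℝ) → ℝ) (hr : ContDiff ℝ 2 r) (hrc : HasCompactSupport r) (x : Fin m → ℝ) :
    auxL A (fun x => ∫ y, ψ y * r (x - y)) x = (∫ y, g y * r (x - y)) +
      ∑ i, ∑ j, (fderiv ℝ (fun z => A z j i) x (Pi.single i (1:ℝ)) *
        (∫ y, fderiv ℝ ψ y (Pi.single j (1:ℝ)) * r (x - y)) +
        ∫ y, ((A x j i - A y j i) * fderiv ℝ ψ y (Pi.single j (1:ℝ))) *
          fderiv ℝ r (x - y) (Pi.single i (1:ℝ))) := by
  have hr1 : ContDiff ℝ 1 r := hr.of_le (by norm_num)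
  have hhc : ∀ j : Fin m, Continuous fun y => fderiv ℝ ψ y (Pi.single j (1:ℝ)) :=
    fun j => aux_fderiv_cont hψ _
  have hshift : ∀ i : Fin m, Continuous fun y => fderiv ℝ r (x - y) (Pi.single i (1:ℝ)) :=
    fun i => (aux_fderiv_cont hr1 _).comp (continuous_const.sub continuous_id)
  have hcs : ∀ i : Fin m, HasCompactSupport fun y => fderiv ℝ r (x - y) (Pi.single i (1:ℝ)) :=
    fun i => aux_shift_cs _ (aux_fderiv_cs hrc _) x
  have hI : ∀ i j, Integrable (fun y => (A y j i * fderiv ℝ ψ y (Pi.single j (1:ℝ))) *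
      fderiv ℝ r (x - y) (Pi.single i (1:ℝ))) volume := fun i j =>
    (((hA j i).continuous.mul (hhc j)).mul (hshift i)).integrable_of_hasCompactSupport
      (aux_cs_mul_left (hcs i))
  have hI' : ∀ i j, Integrable (fun y => A x j i * (fderiv ℝ ψ y (Pi.single j (1:ℝ)) *
      fderiv ℝ r (x - y) (Pi.single i (1:ℝ)))) volume := fun i j =>
    (((hhc j).mul (hshift i)).integrable_of_hasCompactSupport
      (aux_cs_mul_left (hcs i))).const_mul _
  have hg : ∫ y, g y * r (x - y) = ∑ i, ∑ j, ∫ y, (A y j i * fderiv ℝ ψ y (Pi.single j (1:ℝ))) *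
      fderiv ℝ r (x - y) (Pi.single i (1:ℝ)) := by
    have h1 := hweak (fun y => r (x - y)) (hr1.comp (contDiff_const.sub contDiff_id))
      (aux_shift_cs r hrc x)
    have h2 : ∀ y v, fderiv ℝ (fun y => r (x - y)) y v = - fderiv ℝ r (x - y) v := by
      intro y v
      have h3 := ((hr1.differentiable one_ne_zero (x - y)).hasFDerivAt.comp y
        ((hasFDerivAt_id (𝕜 := ℝ) y).const_sub x)).fderiv
      have h4 : fderiv ℝ (fun y => r (x - y)) y = _ := h3
      rw [h4]; simp
    simp only [h2, mul_neg, Finset.sum_neg_distrib, integral_neg] at h1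
    rw [← neg_injective h1]
    simp only [Finset.sum_mul]
    rw [integral_finsetSum _ fun i _ => integrable_finsetSum _ fun j _ => hI i j]
    exact Finset.sum_congr rfl fun i _ => integral_finsetSum _ fun j _ => hI i j
  rw [hg, ← Finset.sum_add_distrib]
  unfold auxL
  refine Finset.sum_congr rfl fun i _ => ?_
  simp only [aux_conv_left ψ r hψ hψc hr1.continuous]
  have hd : ∀ j, HasFDerivAt (fun z => A z j i * ∫ y, fderiv ℝ ψ y (Pi.single j (1:ℝ)) * r (z - y))
      _ x := fun j => ((hA j i).differentiable one_ne_zero x).hasFDerivAt.mul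
        (aux_conv_right _ r (hhc j) hr1 hrc x).1.hasFDerivAt
  rw [(HasFDerivAt.fun_sum fun j _ => hd j).fderiv, ← Finset.sum_add_distrib,
    ContinuousLinearMap.sum_apply]
  refine Finset.sum_congr rfl fun j _ => ?_
  have e1 : ∫ y, ((A x j i - A y j i) * fderiv ℝ ψ y (Pi.single j (1:ℝ))) *
          fderiv ℝ r (x - y) (Pi.single i (1:ℝ)) = A x j i * (∫ y, fderiv ℝ ψ y (Pi.single j (1:ℝ)) *
      fderiv ℝ r (x - y) (Pi.single i (1:ℝ))) - ∫ y, (A y j i * fderiv ℝ ψ y (Pi.single j (1:ℝ))) *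
      fderiv ℝ r (x - y) (Pi.single i (1:ℝ)) := by
    rw [← integral_const_mul, ← integral_sub (hI' i j) (hI i j)]
    congr 1; ext y; ring
  rw [e1]
  simp only [ContinuousLinearMap.add_apply, ContinuousLinearMap.smul_apply, smul_eq_mul,
    (aux_conv_right _ r (hhc j) hr1 hrc x).2]
  ring

theorem aux_scale {m : ℕ} (h k : (Fin m → ℝ) → ℝ) (ε : ℝ) (hε : 0 < ε) (x : Fin m → ℝ) :
    ∫ y, h y * ((ε ^ m)⁻¹ * k (ε⁻¹ • (x - y))) = ∫ z, h (x - ε • z) * k z := by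
  rw [← integral_sub_left_eq_self _ _ x]
  have := Measure.integral_comp_smul_of_nonneg (volume : Measure (Fin m → ℝ))
    (fun t => h (x - t) * k (ε⁻¹ • t)) ε (hR := hε.le)
  simp only [smul_smul, inv_mul_cancel₀ hε.ne', one_smul] at this
  rw [this]
  simp only [sub_sub_cancel, Module.finrank_fin_fun, smul_eq_mul]
  rw [← integral_const_mul]
  congr 1; ext y; ring

theorem aux_lim {m : ℕ} (k : (Fin m → ℝ) → ℝ) (hk : Continuous k) (hk0 : ∀ z, 1 < ‖z‖ → k z = 0)
    (q : ℕ → (Fin m → ℝ) → ℝ) (hq : ∀ n, Continuous (q n)) (q' : (Fin m → ℝ) → ℝ) (c : ℝ)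
    (hc : ∀ n z, ‖z‖ ≤ 1 → |q n z| ≤ c)
    (hl : ∀ z, Filter.Tendsto (fun n => q n z) Filter.atTop (nhds (q' z))) :
    Filter.Tendsto (fun n => ∫ z, q n z * k z) Filter.atTop (nhds (∫ z, q' z * k z)) := by
  have hkc : HasCompactSupport k := HasCompactSupport.intro (isCompact_closedBall 0 1)
    fun z hz => hk0 z (by simpa using hz)
  refine tendsto_integral_of_dominated_convergence (fun z => c * |k z|)
    (fun n => ((hq n).mul hk).aestronglyMeasurable)
    ((hk.abs.integrable_of_hasCompactSupport hkc.norm).const_mul c)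
    (fun n => Filter.Eventually.of_forall fun z => ?_)
    (Filter.Eventually.of_forall fun z => (hl z).mul_const _)
  rw [Real.norm_eq_abs, abs_mul]
  by_cases hz : ‖z‖ ≤ 1
  · exact mul_le_mul_of_nonneg_right (hc n z hz) (abs_nonneg _)
  · simp [hk0 z (not_le.1 hz)]

theorem aux_bd {m : ℕ} (k : (Fin m → ℝ) → ℝ) (hk : Continuous k) (hk0 : ∀ z, 1 < ‖z‖ → k z = 0)
    (q : (Fin m → ℝ) → ℝ) (c : ℝ) (hc : ∀ z, ‖z‖ ≤ 1 → |q z| ≤ c) :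
    |∫ z, q z * k z| ≤ c * ∫ z, |k z| := by
  have hkc : HasCompactSupport k := HasCompactSupport.intro (isCompact_closedBall 0 1)
    fun z hz => hk0 z (by simpa using hz)
  rw [← integral_const_mul, ← Real.norm_eq_abs]
  refine norm_integral_le_of_norm_le 
    ((hk.abs.integrable_of_hasCompactSupport hkc.norm).const_mul c)
    (Filter.Eventually.of_forall fun z => ?_)
  rw [Real.norm_eq_abs, abs_mul]
  by_cases hz : ‖z‖ ≤ 1
  · exact mul_le_mul_of_nonneg_right (hc z hz) (abs_nonneg _)
  · simp [hk0 z (not_le.1 hz)]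

theorem aux_dct {m : ℕ} (u : (Fin m → ℝ) → ℝ) (hu : LocallyIntegrable u volume)
    (f : ℕ → (Fin m → ℝ) → ℝ) (hf : ∀ n, Continuous (f n)) (f' : (Fin m → ℝ) → ℝ) (c R : ℝ)
    (hc : ∀ n x, |f n x| ≤ c) (hR : ∀ n x, R < ‖x‖ → f n x = 0)
    (hl : ∀ x, Filter.Tendsto (fun n => f n x) Filter.atTop (nhds (f' x))) :
    Filter.Tendsto (fun n => ∫ x, u x * f n x) Filter.atTop (nhds (∫ x, u x * f' x)) := by
  refine tendsto_integral_of_dominated_convergence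
    (fun x => (Metric.closedBall (0 : Fin m → ℝ) R).indicator (fun x => |u x| * c) x)
    (fun n => hu.aestronglyMeasurable.mul (hf n).aestronglyMeasurable)
    (IntegrableOn.integrable_indicator
      ((hu.integrableOn_isCompact (isCompact_closedBall 0 R)).abs.mul_const c)
      measurableSet_closedBall)
    (fun n => Filter.Eventually.of_forall fun x => ?_)
    (Filter.Eventually.of_forall fun x => (hl x).const_mul _)
  rw [Real.norm_eq_abs, abs_mul]
  by_cases hx : ‖x‖ ≤ R
  · rw [indicator_of_mem (by simpa using hx)]
    exact mul_le_mul_of_nonneg_left (hc n x) (abs_nonneg _)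
  · rw [indicator_of_notMem (by simpa using hx)]
    simp [hR n x (not_le.1 hx)]

end P5

section P6
open Set

theorem aux_eps_pos (n : ℕ) : (0:ℝ) < 1 / ((n:ℝ) + 1) := by positivity
theorem aux_eps_le (n : ℕ) : 1 / ((n:ℝ) + 1) ≤ 1 := by
  rw [div_le_one (by positivity)]; linarith [n.cast_nonneg (α := ℝ)]

theorem aux_eps_smul {m : ℕ} (n : ℕ) (z : Fin m → ℝ) (hz : ‖z‖ ≤ 1) :
    ‖(1 / ((n:ℝ) + 1)) • z‖ ≤ 1 := by
  rw [norm_smul, Real.norm_of_nonneg (aux_eps_pos n).le]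
  exact mul_le_one₀ (aux_eps_le n) (norm_nonneg _) hz

theorem aux_far {m : ℕ} (n : ℕ) (h : (Fin m → ℝ) → ℝ) (R : ℝ) (hR : ∀ x, R < ‖x‖ → h x = 0)
    (x z : Fin m → ℝ) (hx : R + 1 < ‖x‖) (hz : ‖z‖ ≤ 1) : h (x - (1 / ((n:ℝ) + 1)) • z) = 0 := by
  apply hR
  have := norm_sub_norm_le x ((1 / ((n:ℝ) + 1)) • z)
  have := aux_eps_smul n z hz
  linarith

theorem aux_diffquot {m : ℕ} (a : (Fin m → ℝ) → ℝ) (x z : Fin m → ℝ) (ha : DifferentiableAt ℝ a x) :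
    Filter.Tendsto (fun n : ℕ => (1 / ((n:ℝ) + 1))⁻¹ * (a x - a (x - (1 / ((n:ℝ) + 1)) • z)))
      Filter.atTop (nhds (fderiv ℝ a x z)) := by
  have h1 : HasDerivAt (fun t : ℝ => x - t • z) (-z) 0 := by
    simpa using ((hasDerivAt_id (0:ℝ)).smul_const z).const_sub x
  have h2 : HasDerivAt (fun t : ℝ => a (x - t • z)) (fderiv ℝ a x (-z)) 0 := by
    have h3 : HasFDerivAt a (fderiv ℝ a x) (x - (0:ℝ) • z) := by simpa using ha.hasFDerivAt
    exact h3.comp_hasDerivAt 0 h1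
  rw [hasDerivAt_iff_tendsto_slope_zero] at h2
  have h4 : Filter.Tendsto (fun n : ℕ => 1 / ((n:ℝ) + 1)) Filter.atTop (nhdsWithin 0 {0}ᶜ) := by
    rw [tendsto_nhdsWithin_iff]
    exact ⟨tendsto_one_div_add_atTop_nhds_zero_nat, Filter.Eventually.of_forall fun n =>
      (aux_eps_pos n).ne'⟩
  have h5 := (h2.comp h4).neg
  simp only [map_neg, neg_neg] at h5
  refine h5.congr fun n => ?_
  simp only [Function.comp, zero_add, zero_smul, sub_zero, smul_eq_mul]
  ring

theorem aux_shift_lim {m : ℕ} (h : (Fin m → ℝ) → ℝ) (hh : Continuous h) (x z : Fin m → ℝ) :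
    Filter.Tendsto (fun n : ℕ => h (x - (1 / ((n:ℝ) + 1)) • z)) Filter.atTop (nhds (h x)) := by
  have h1 : Filter.Tendsto (fun n : ℕ => x - (1 / ((n:ℝ) + 1)) • z) Filter.atTop
      (nhds (x - (0:ℝ) • z)) :=
    (tendsto_one_div_add_atTop_nhds_zero_nat.smul_const z).const_sub x
  rw [zero_smul, sub_zero] at h1
  exact (hh.tendsto x).comp h1

/-- smoothing of a continuous compactly supported function -/
theorem aux_smooth {m : ℕ} (h : (Fin m → ℝ) → ℝ) (hh : Continuous h) (H : ℝ)
    (hH : ∀ x, |h x| ≤ H) (R : ℝ) (hR : ∀ x, R < ‖x‖ → h x = 0)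
    (ρ : (Fin m → ℝ) → ℝ) (hρ : Continuous ρ) (hρ0 : ∀ z, 1 < ‖z‖ → ρ z = 0) (hρ1 : ∫ z, ρ z = 1) :
    (∀ x, Filter.Tendsto (fun n : ℕ => ∫ z, h (x - (1 / ((n:ℝ) + 1)) • z) * ρ z) Filter.atTop
      (nhds (h x))) ∧ (∀ (n : ℕ) x, |∫ z, h (x - (1 / ((n:ℝ) + 1)) • z) * ρ z| ≤ H * ∫ z, |ρ z|) ∧
    ∀ (n : ℕ) x, R + 1 < ‖x‖ → ∫ z, h (x - (1 / ((n:ℝ) + 1)) • z) * ρ z = 0 := by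
  refine ⟨fun x => ?_, fun n x => ?_, fun n x hx => ?_⟩
  · have := aux_lim ρ hρ hρ0 (fun n z => h (x - (1 / ((n:ℝ) + 1)) • z)) (fun n => by fun_prop)
      (fun _ => h x) H (fun n z _ => hH _) (fun z => aux_shift_lim h hh x z)
    simpa [integral_const_mul, hρ1] using this
  · exact aux_bd ρ hρ hρ0 _ H fun z _ => hH _
  · refine integral_eq_zero_of_ae (Filter.Eventually.of_forall fun z => ?_)
    by_cases hz : ‖z‖ ≤ 1
    · simp only [aux_far n h R hR x z hx hz, zero_mul, Pi.zero_apply]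
    · simp [hρ0 z (not_le.1 hz)]

theorem aux_fderiv_zero {m : ℕ} (ρ : (Fin m → ℝ) → ℝ) (hρ0 : ∀ z, 1 < ‖z‖ → ρ z = 0)
    (v z : Fin m → ℝ) (hz : 1 < ‖z‖) : fderiv ℝ ρ z v = 0 := by
  have : ρ =ᶠ[nhds z] fun _ => 0 := by
    filter_upwards [(isOpen_lt continuous_const continuous_norm).mem_nhds hz] with y hy
    exact hρ0 y hy
  rw [this.fderiv_eq]; simp

/-- commutator term -/
theorem aux_commut {m : ℕ} (a : (Fin m → ℝ) → ℝ) (ha : ContDiff ℝ 1 a)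
    (h : (Fin m → ℝ) → ℝ) (hh : Continuous h) (H : ℝ)
    (hH : ∀ x, |h x| ≤ H) (R : ℝ) (hR : ∀ x, R < ‖x‖ → h x = 0)
    (ρ : (Fin m → ℝ) → ℝ) (hρ : ContDiff ℝ 1 ρ) (hρ0 : ∀ z, 1 < ‖z‖ → ρ z = 0)
    (hρ1 : ∫ z, ρ z = 1) (v : Fin m → ℝ) (T : ℕ → (Fin m → ℝ) → ℝ)
    (hT : ∀ n x, T n x = fderiv ℝ a x v * (∫ z, h (x - (1 / ((n:ℝ) + 1)) • z) * ρ z) +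
      ∫ z, ((a x - a (x - (1 / ((n:ℝ) + 1)) • z)) * h (x - (1 / ((n:ℝ) + 1)) • z)) *
        ((1 / ((n:ℝ) + 1))⁻¹ * fderiv ℝ ρ z v)) :
    (∀ x, Filter.Tendsto (fun n => T n x) Filter.atTop (nhds 0)) ∧
    (∃ c, ∀ n x, |T n x| ≤ c) ∧ ∀ n x, R + 1 < ‖x‖ → T n x = 0 := by
  have hρc : HasCompactSupport ρ := HasCompactSupport.intro (isCompact_closedBall 0 1)
    fun z hz => hρ0 z (by simpa using hz)
  obtain ⟨s1, s2, s3⟩ := aux_smooth h hh H hH R hR ρ hρ.continuous hρ0 hρ1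
  have hH0 : 0 ≤ H := (abs_nonneg _).trans (hH 0)
  obtain ⟨M, hM⟩ := (isCompact_closedBall (0 : Fin m → ℝ) (R + 2)).exists_bound_of_continuousOn
    (ha.continuous_fderiv one_ne_zero).continuousOn
  have hk := aux_fderiv_cont hρ v
  have hk0 := aux_fderiv_zero ρ hρ0 v
  have hq : ∀ (n : ℕ) x, ∫ z, ((a x - a (x - (1 / ((n:ℝ) + 1)) • z)) * h (x - (1 / ((n:ℝ) + 1)) • z)) *
        ((1 / ((n:ℝ) + 1))⁻¹ * fderiv ℝ ρ z v) =
      ∫ z, ((1 / ((n:ℝ) + 1))⁻¹ * (a x - a (x - (1 / ((n:ℝ) + 1)) • z)) *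
        h (x - (1 / ((n:ℝ) + 1)) • z)) * fderiv ℝ ρ z v := by
    intro n x; congr 1; ext z; ring
  have hqfar : ∀ (n : ℕ) x, R + 1 < ‖x‖ → ∀ z, ‖z‖ ≤ 1 →
      (1 / ((n:ℝ) + 1))⁻¹ * (a x - a (x - (1 / ((n:ℝ) + 1)) • z)) *
        h (x - (1 / ((n:ℝ) + 1)) • z) = 0 := by
    intro n x hx z hz
    rw [aux_far n h R hR x z hx hz, mul_zero]
  have hqb : ∀ (n : ℕ) x z, ‖z‖ ≤ 1 →
      |(1 / ((n:ℝ) + 1))⁻¹ * (a x - a (x - (1 / ((n:ℝ) + 1)) • z)) *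
        h (x - (1 / ((n:ℝ) + 1)) • z)| ≤ |M| * H := by
    intro n x z hz
    by_cases hx : R + 1 < ‖x‖
    · rw [hqfar n x hx z hz, abs_zero]; positivity
    have hx' := not_lt.1 hx
    have he := aux_eps_pos n
    have hez := aux_eps_smul n z hz
    rw [abs_mul]
    refine mul_le_mul ?_ (hH _) (abs_nonneg _) (abs_nonneg _)
    have hL := (convex_closedBall (0 : Fin m → ℝ) (R + 2)).norm_image_sub_le_of_norm_fderiv_le
      (𝕜 := ℝ) (f := a) (C := |M|) (fun y _ => ha.differentiable one_ne_zero y)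
      (fun y hy => (hM y hy).trans (le_abs_self M))
      (x := x - (1 / ((n:ℝ) + 1)) • z) (y := x)
      (by rw [mem_closedBall_zero_iff]; have := norm_sub_le x ((1 / ((n:ℝ) + 1)) • z); linarith)
      (by rw [mem_closedBall_zero_iff]; linarith)
    rw [sub_sub_cancel, norm_smul, Real.norm_of_nonneg he.le, Real.norm_eq_abs] at hL
    rw [abs_mul, abs_of_pos (inv_pos.2 he), inv_mul_le_iff₀ he]
    calc _ ≤ _ := hL
      _ ≤ |M| * ((1 / ((n:ℝ) + 1)) * 1) := by gcongr
      _ = _ := by ring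
  refine ⟨fun x => ?_, ⟨|M| * ‖v‖ * (H * ∫ z, |ρ z|) + |M| * H * ∫ z, |fderiv ℝ ρ z v|, fun n x => ?_⟩,
    fun n x hx => ?_⟩
  · simp only [hT, hq]
    have l2 := aux_lim _ hk hk0 (fun n z => (1 / ((n:ℝ) + 1))⁻¹ *
        (a x - a (x - (1 / ((n:ℝ) + 1)) • z)) * h (x - (1 / ((n:ℝ) + 1)) • z))
      (fun n => by have := ha.continuous; fun_prop)
      (fun z => fderiv ℝ a x z * h x) (|M| * H) (fun n z hz => hqb n x z hz)
      (fun z => (aux_diffquot a x z (ha.differentiable one_ne_zero x)).mul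
        (aux_shift_lim h hh x z))
    have l1 := (s1 x).const_mul (fderiv ℝ a x v)
    have hcl : Continuous (fun z => fderiv ℝ a x z) := (fderiv ℝ a x).continuous
    have ibp : ∫ z, fderiv ℝ a x z * fderiv ℝ ρ z v = - fderiv ℝ a x v := by
      have hf : ∀ z, fderiv ℝ (fun z => fderiv ℝ a x z) z = fderiv ℝ a x := fun z =>
        (fderiv ℝ a x).fderiv
      have := integral_mul_fderiv_eq_neg_fderiv_mul_of_integrable (μ := volume) (v := v)
        (f := fun z => fderiv ℝ a x z) (g := ρ) 
        (by simp only [hf]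
            exact (hρ.continuous.integrable_of_hasCompactSupport hρc).const_mul _)
        ((hcl.mul hk).integrable_of_hasCompactSupport (aux_cs_mul_left (aux_fderiv_cs hρc v)))
        ((hcl.mul hρ.continuous).integrable_of_hasCompactSupport (aux_cs_mul_left hρc))
        (fun y _ => (fderiv ℝ a x).differentiableAt)
        (fun y _ => hρ.differentiable one_ne_zero y)
      rw [this]
      simp only [hf]
      rw [integral_const_mul, hρ1, mul_one]
    have e : ∫ z, fderiv ℝ a x z * h x * fderiv ℝ ρ z v = - (fderiv ℝ a x v * h x) := by
      rw [← neg_mul, ← ibp, ← integral_mul_const]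
      congr 1; ext z; ring
    rw [e] at l2
    have := l1.add l2
    rwa [add_neg_cancel] at this
  · by_cases hx : R + 1 < ‖x‖
    · rw [hT, s3 n x hx, hq]
      have := aux_bd _ hk hk0 (fun z => (1 / ((n:ℝ) + 1))⁻¹ *
        (a x - a (x - (1 / ((n:ℝ) + 1)) • z)) * h (x - (1 / ((n:ℝ) + 1)) • z)) _ (hqb n x)
      rw [mul_zero, zero_add]
      refine this.trans (le_add_of_nonneg_left ?_)
      have : 0 ≤ ∫ z, |ρ z| := integral_nonneg fun z => abs_nonneg _
      positivity
    · rw [hT, hq]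
      refine (abs_add_le _ _).trans (add_le_add ?_ (aux_bd _ hk hk0 _ _ (hqb n x)))
      rw [abs_mul]
      refine mul_le_mul ?_ (s2 n x) (abs_nonneg _) (by positivity)
      refine ((fderiv ℝ a x).le_opNorm v).trans ?_
      gcongr
      refine (hM x ?_).trans (le_abs_self M)
      rw [mem_closedBall_zero_iff]; linarith
  · rw [hT, s3 n x hx, mul_zero, zero_add, hq]
    refine integral_eq_zero_of_ae (Filter.Eventually.of_forall fun z => ?_)
    by_cases hz : ‖z‖ ≤ 1
    · simp only [hqfar n x hx z hz, zero_mul, Pi.zero_apply]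
    · simp [hk0 z (not_le.1 hz)]

end P6

section P7
open Set

theorem aux_fried {m : ℕ} (A : (Fin m → ℝ) → Matrix (Fin m) (Fin m) ℝ)
    (hA : ∀ i j, ContDiff ℝ 1 (fun y => A y i j))
    (ψ g : (Fin m → ℝ) → ℝ) (hψ : ContDiff ℝ 1 ψ) (hψc : HasCompactSupport ψ)
    (hg : Continuous g) (hgc : HasCompactSupport g)
    (hweak : ∀ η : (Fin m → ℝ) → ℝ, ContDiff ℝ 1 η → HasCompactSupport η →
      ∫ y, ∑ i, (∑ j, A y j i * fderiv ℝ ψ y (Pi.single j (1:ℝ))) *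
        fderiv ℝ η y (Pi.single i (1:ℝ)) = - ∫ y, g y * η y)
    (u w : (Fin m → ℝ) → ℝ) (hu : LocallyIntegrable u volume) (hw : LocallyIntegrable w volume)
    (huw : ∀ φ : (Fin m → ℝ) → ℝ, ContDiff ℝ 2 φ → HasCompactSupport φ →
      ∫ y, u y * auxL A φ y = ∫ y, w y * φ y) :
    ∫ y, u y * g y = ∫ y, w y * ψ y := by
  -- the mollifier
  let B : ContDiffBump (0 : Fin m → ℝ) := ⟨1/2, 1, by norm_num, by norm_num⟩
  obtain ⟨ρ, hρ, hρ0, hρ1⟩ : ∃ ρ : (Fin m → ℝ) → ℝ, ContDiff ℝ 2 ρ ∧ (∀ z, 1 < ‖z‖ → ρ z = 0) ∧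
      ∫ z, ρ z = 1 := by
    refine ⟨B.normed volume, B.contDiff_normed (n := 2), fun z hz => ?_, B.integral_normed⟩
    by_contra hne
    have : z ∈ Function.support (B.normed volume) := hne
    rw [B.support_normed_eq, mem_ball_zero_iff] at this
    have h1 : B.rOut = 1 := rfl
    linarith
  have hρC1 : ContDiff ℝ 1 ρ := hρ.of_le (by norm_num)
  have hρc : HasCompactSupport ρ := HasCompactSupport.intro (isCompact_closedBall 0 1)
    fun z hz => hρ0 z (by simpa using hz)
  -- bounds on data
  have hdata : ∀ h : (Fin m → ℝ) → ℝ, Continuous h → HasCompactSupport h →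
      ∃ H, ∀ x, |h x| ≤ H := by
    intro h hh hhc
    obtain ⟨H, hH⟩ := hhc.exists_bound_of_continuous hh
    exact ⟨H, hH⟩
  obtain ⟨R1, hR1⟩ := (hψc.isCompact).isBounded.subset_closedBall (0 : Fin m → ℝ)
  obtain ⟨R2, hR2⟩ := (hgc.isCompact).isBounded.subset_closedBall (0 : Fin m → ℝ)
  let R := max R1 R2
  have hψR : ∀ x, R < ‖x‖ → x ∉ tsupport ψ := fun x hx hmem => by
    have := mem_closedBall_zero_iff.1 (hR1 hmem)
    exact absurd (hx.trans_le this) (not_lt.2 (le_max_left _ _))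
  have hψR0 : ∀ x, R < ‖x‖ → ψ x = 0 := fun x hx => image_eq_zero_of_notMem_tsupport (hψR x hx)
  have hdψR : ∀ v x, R < ‖x‖ → fderiv ℝ ψ x v = 0 := fun v x hx => by
    have : fderiv ℝ ψ x = 0 := by
      by_contra h
      exact hψR x hx (support_fderiv_subset ℝ h)
    simp [this]
  have hgR : ∀ x, R < ‖x‖ → g x = 0 := fun x hx => by
    apply image_eq_zero_of_notMem_tsupport
    intro hmem
    have := mem_closedBall_zero_iff.1 (hR2 hmem)
    exact absurd (hx.trans_le this) (not_lt.2 (le_max_right _ _))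
  obtain ⟨Hψ, hHψ⟩ := hdata ψ hψ.continuous hψc
  obtain ⟨Hg, hHg⟩ := hdata g hg hgc
  choose Hd hHd using fun j : Fin m => hdata (fun y => fderiv ℝ ψ y (Pi.single j (1:ℝ)))
    (aux_fderiv_cont hψ _) (aux_fderiv_cs hψc _)
  -- scaled mollifier
  let r : ℕ → (Fin m → ℝ) → ℝ := fun n t =>
    ((1 / ((n:ℝ) + 1)) ^ m)⁻¹ * ρ ((1 / ((n:ℝ) + 1))⁻¹ • t)
  have hr : ∀ n, ContDiff ℝ 2 (r n) := fun n =>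
    contDiff_const.mul (hρ.comp (contDiff_const_smul _))
  have hrc : ∀ n, HasCompactSupport (r n) := fun n =>
    aux_cs_mul_left (hρc.comp_smul (inv_ne_zero (aux_eps_pos n).ne'))
  have hdr : ∀ n t v, fderiv ℝ (r n) t v = ((1 / ((n:ℝ) + 1)) ^ m)⁻¹ *
      ((1 / ((n:ℝ) + 1))⁻¹ * fderiv ℝ ρ ((1 / ((n:ℝ) + 1))⁻¹ • t) v) := by
    intro n t v
    have h1 := ((hρC1.differentiable one_ne_zero ((1 / ((n:ℝ) + 1))⁻¹ • t)).hasFDerivAt.comp t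
      ((hasFDerivAt_id (𝕜 := ℝ) t).const_smul ((1 / ((n:ℝ) + 1))⁻¹))).const_mul
        (((1 / ((n:ℝ) + 1)) ^ m)⁻¹)
    have h2 : HasFDerivAt (r n) _ t := h1
    rw [h2.fderiv]
    simp
  have hrs : ∀ (h : (Fin m → ℝ) → ℝ) n x, ∫ y, h y * r n (x - y) =
      ∫ z, h (x - (1 / ((n:ℝ) + 1)) • z) * ρ z := fun h n x =>
    aux_scale h ρ _ (aux_eps_pos n) x
  have hdrs : ∀ (h : (Fin m → ℝ) → ℝ) n x v, ∫ y, h y * fderiv ℝ (r n) (x - y) v =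
      ∫ z, h (x - (1 / ((n:ℝ) + 1)) • z) * ((1 / ((n:ℝ) + 1))⁻¹ * fderiv ℝ ρ z v) := fun h n x v => by
    simp only [hdr]
    exact aux_scale h (fun z => (1 / ((n:ℝ) + 1))⁻¹ * fderiv ℝ ρ z v) _ (aux_eps_pos n) x
  -- mollified functions
  let Ψ : ℕ → (Fin m → ℝ) → ℝ := fun n x => ∫ y, ψ y * r n (x - y)
  obtain ⟨p1, p2, p3⟩ := aux_smooth ψ hψ.continuous Hψ hHψ R hψR0 ρ hρ.continuous hρ0 hρ1
  obtain ⟨g1, g2, g3⟩ := aux_smooth g hg Hg hHg R hgR ρ hρ.continuous hρ0 hρ1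
  have hΨ : ∀ n, ContDiff ℝ 2 (Ψ n) := fun n => aux_conv_C2 ψ (r n) hψ.continuous (hr n) (hrc n)
  have hΨ0 : ∀ n x, R + 1 < ‖x‖ → Ψ n x = 0 := fun n x hx => by
    change ∫ y, ψ y * r n (x - y) = 0
    rw [hrs, p3 n x hx]
  have hΨc : ∀ n, HasCompactSupport (Ψ n) := fun n =>
    HasCompactSupport.intro (isCompact_closedBall 0 (R + 1)) fun z hz => hΨ0 n z (by simpa using hz)
  have limw : Filter.Tendsto (fun n => ∫ y, w y * Ψ n y) Filter.atTop (nhds (∫ y, w y * ψ y)) := by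
    refine aux_dct w hw Ψ (fun n => (hΨ n).continuous) ψ (Hψ * ∫ z, |ρ z|) (R + 1) (fun n x => ?_)
      hΨ0 fun x => ?_
    · change |∫ y, ψ y * r n (x - y)| ≤ _
      rw [hrs]; exact p2 n x
    · change Filter.Tendsto (fun n => ∫ y, ψ y * r n (x - y)) _ _
      simp only [hrs]; exact p1 x
  let T : Fin m → Fin m → ℕ → (Fin m → ℝ) → ℝ := fun i j n x =>
    fderiv ℝ (fun z => A z j i) x (Pi.single i (1:ℝ)) *
        (∫ z, fderiv ℝ ψ (x - (1 / ((n:ℝ) + 1)) • z) (Pi.single j (1:ℝ)) * ρ z) +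
      ∫ z, ((A x j i - A (x - (1 / ((n:ℝ) + 1)) • z) j i) *
        fderiv ℝ ψ (x - (1 / ((n:ℝ) + 1)) • z) (Pi.single j (1:ℝ))) *
        ((1 / ((n:ℝ) + 1))⁻¹ * fderiv ℝ ρ z (Pi.single i (1:ℝ)))
  have hT := fun i j => aux_commut (fun z => A z j i) (hA j i)
    (fun y => fderiv ℝ ψ y (Pi.single j (1:ℝ))) (aux_fderiv_cont hψ _) (Hd j) (hHd j) R
    (hdψR _) ρ hρC1 hρ0 hρ1 (Pi.single i (1:ℝ)) (T i j) (fun n x => rfl)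
  choose t1 t2 t3 using hT
  choose c hc using t2
  have hLΨ : ∀ n x, auxL A (Ψ n) x = (∫ z, g (x - (1 / ((n:ℝ) + 1)) • z) * ρ z) +
      ∑ i, ∑ j, T i j n x := by
    intro n x
    have := aux_auxL_conv A hA ψ g hψ hψc hweak (r n) (hr n) (hrc n) x
    change auxL A (Ψ n) x = _ at this
    rw [this, hrs]
    congr 1
    refine Finset.sum_congr rfl fun i _ => Finset.sum_congr rfl fun j _ => ?_
    rw [hrs (fun y => fderiv ℝ ψ y (Pi.single j (1:ℝ)))]
    rw [hdrs (fun y => (A x j i - A y j i) * fderiv ℝ ψ y (Pi.single j (1:ℝ)))]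
  have limu : Filter.Tendsto (fun n => ∫ y, u y * auxL A (Ψ n) y) Filter.atTop
      (nhds (∫ y, u y * g y)) := by
    refine aux_dct u hu (fun n => auxL A (Ψ n)) (fun n => auxL_cont A hA _ (hΨ n)) g
      (Hg * (∫ z, |ρ z|) + ∑ i, ∑ j, c i j) (R + 1) (fun n x => ?_) (fun n x hx => ?_) fun x => ?_
    · rw [hLΨ]
      refine (abs_add_le _ _).trans (add_le_add (g2 n x) ?_)
      refine (Finset.abs_sum_le_sum_abs _ _).trans (Finset.sum_le_sum fun i _ => ?_)
      exact (Finset.abs_sum_le_sum_abs _ _).trans (Finset.sum_le_sum fun j _ => hc i j n x)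
    · simp only [hLΨ, g3 n x hx, t3 _ _ n x hx, Finset.sum_const_zero, add_zero]
    · simp only [hLΨ]
      have := (g1 x).add (tendsto_finsetSum Finset.univ fun i _ =>
        tendsto_finsetSum Finset.univ fun j _ => t1 i j x)
      simpa only [Finset.sum_const_zero, add_zero] using this
  simp only [fun n => huw (Ψ n) (hΨ n) (hΨc n)] at limu
  exact tendsto_nhds_unique limu limw

end P7

section P8
open Set

theorem aux_hilbert {X : Type*} [NormedAddCommGroup X] [InnerProductSpace ℝ X] [CompleteSpace X]
    (V : ℝ → X → X) (hVadd : ∀ s x y, V s (x + y) = V s x + V s y)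
    (hVadj : ∀ s x y, inner ℝ (V s x) y = inner ℝ x (V (-s) y))
    (S : Set X)
    (hS : ∀ x, (∀ p ∈ S, inner ℝ p x = 0) → ∀ s, ∀ p ∈ S, inner ℝ p (V s x) = 0)
    (x f : X) (hx : ∀ p ∈ S, inner ℝ p x = 0) (hf : ∀ s, V s f = f)
    (hxf : ∀ g, (∀ s, V s g = g) → inner ℝ (x - f) g = 0) :
    ∀ p ∈ S, inner ℝ p f = 0 := by
  let D : Submodule ℝ X := (Submodule.span ℝ S)ᗮ
  have hD : ∀ x, x ∈ D ↔ ∀ p ∈ S, inner ℝ p x = 0 := by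
    intro x
    constructor
    · intro h p hp
      exact (Submodule.mem_orthogonal _ _).1 h p (Submodule.subset_span hp)
    · intro h
      rw [Submodule.mem_orthogonal]
      intro q hq
      induction hq using Submodule.span_induction with
      | mem p hp => exact h p hp
      | zero => simp
      | add p q _ _ h1 h2 => rw [inner_add_left, h1, h2, add_zero]
      | smul a p _ h1 => rw [inner_smul_left, h1, mul_zero]
  have hinv : ∀ s x, x ∈ D → V s x ∈ D := fun s x h => (hD _).2 (hS x ((hD x).1 h) s)
  obtain ⟨p, hp, g, hg, hfg⟩ := D.exists_add_mem_mem_orthogonal f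
  have hgD : ∀ d ∈ D, inner ℝ d g = 0 := (Submodule.mem_orthogonal _ _).1 hg
  have hgfix : ∀ s, V s g = g := by
    intro s
    have h1 : V s p + V s g = p + g := by rw [← hVadd, ← hfg, hf]
    have h2 : V s g - g ∈ D := by
      have : V s g - g = p - V s p := by
        rw [sub_eq_sub_iff_add_eq_add, add_comm (V s g), h1]
      rw [this]
      exact D.sub_mem hp (hinv s p hp)
    have h3 : inner ℝ (V s g - g) (V s g - g) = 0 := by
      have h4 : inner ℝ (V s g - g) (V s g) = 0 := by
        rw [real_inner_comm, hVadj]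
        rw [real_inner_comm]
        exact hgD _ (hinv (-s) _ h2)
      rw [inner_sub_right, h4, hgD _ h2, sub_zero]
    exact sub_eq_zero.1 (inner_self_eq_zero.1 h3)
  have e1 := hxf g hgfix
  rw [inner_sub_left, hgD x ((hD x).2 hx), zero_sub, neg_eq_zero, hfg, inner_add_left,
    hgD p hp, zero_add] at e1
  have : f = p := by rw [hfg, inner_self_eq_zero.1 e1, add_zero]
  rw [this]
  exact (hD p).1 hp

theorem aux_inv {m : ℕ} (b : (Fin m → ℝ) → (Fin m → ℝ)) (hb : ContDiff ℝ 1 b)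
    (C : ℝ) (hC : 0 < C) (hgrow : ∀ y, ‖b y‖ ≤ C * (1 + ‖y‖))
    (Y : ℝ → (Fin m → ℝ) → (Fin m → ℝ))
    (hY0 : ∀ y, Y 0 y = y)
    (hYd : ∀ (s : ℝ) (y : Fin m → ℝ), HasDerivAt (fun t => Y t y) (b (Y s y)) s)
    (hYmp : ∀ s : ℝ, MeasurePreserving (Y s) (volume : Measure (Fin m → ℝ)) volume)
    (A : (Fin m → ℝ) → Matrix (Fin m) (Fin m) ℝ)
    (hA : ∀ i j, ContDiff ℝ 1 (fun y => A y i j))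
    (hbA : ∀ y, (Matrix.of fun i j => fderiv ℝ (fun z => A z i j) y (b y))
        - (Matrix.of fun i j => fderiv ℝ (fun z => b z i) y (Pi.single j (1:ℝ))) * A y
        - A y * ((Matrix.of fun i j => fderiv ℝ (fun z => b z i) y (Pi.single j (1:ℝ)))ᵀ)
        = 0)
    (u w : (Fin m → ℝ) → ℝ) (hu : LocallyIntegrable u volume) (hw : LocallyIntegrable w volume)
    (huw : ∀ φ : (Fin m → ℝ) → ℝ, ContDiff ℝ 2 φ → HasCompactSupport φ →
      ∫ y, u y * auxL A φ y = ∫ y, w y * φ y) (s : ℝ)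
    (φ : (Fin m → ℝ) → ℝ) (hφ : ContDiff ℝ 2 φ) (hφc : HasCompactSupport φ) :
    ∫ y, u (Y s y) * auxL A φ y = ∫ y, w (Y s y) * φ y := by
  have hY1 := fun T => aux_flow_C1 b hb C hC.le hgrow Y hY0 hYd T
  have hinv : ∀ s y, Y (-s) (Y s y) = y := fun s y => by
    rw [aux_group b hb Y hY0 hYd, neg_add_cancel, hY0]
  have hinv' : ∀ y, Y s (Y (-s) y) = y := fun y => by simpa using hinv (-s) y
  let e : (Fin m → ℝ) ≃ₜ (Fin m → ℝ) :=
    { toFun := Y (-s), invFun := Y s, left_inv := hinv', right_inv := hinv s,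
      continuous_toFun := (hY1 (-s)).continuous, continuous_invFun := (hY1 s).continuous }
  have hchange : ∀ (v F : (Fin m → ℝ) → ℝ), 
      ∫ y, v (Y s y) * F y = ∫ y, v y * F (Y (-s) y) := by
    intro v F
    have := (hYmp s).integral_comp e.symm.measurableEmbedding (fun y => v y * F (Y (-s) y))
    rw [← this]
    simp only [hinv]
  rw [hchange, hchange]
  refine aux_fried A hA (fun y => φ (Y (-s) y)) (fun y => auxL A φ (Y (-s) y))
    ((hφ.of_le (by norm_num)).comp (hY1 (-s))) (hφc.comp_homeomorph e)
    ((auxL_cont A hA φ hφ).comp (hY1 (-s)).continuous) ((auxL_cs A φ hφc).comp_homeomorph e)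
    (fun η hη hηc => ?_) u w hu hw huw
  exact aux_weak A hA (Y (-s)) (Y s) (hY1 _) (hY1 _) (hinv s) hinv' (hYmp _)
    (fun y i j => aux_conj b hb C hC.le hgrow Y hY0 hYd A hA hbA (-s) y i j) φ hφ η hη hηc

end P8

/-- Let `b` be a `C¹` divergence-free vector field with linear growth
and measure-preserving flow `Y`, `K ⊆ L²` the subspace of flow-invariant functions and
`⟨·⟩` the orthogonal projection onto `K` (encoded by `Pu`, `Pw` and the orthogonality
relations).  Let `A` be a `C¹` matrix field with `[b,A] = 0`.  If `u, w ∈ L²` satisfy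
`∫ u div(ᵗA ∇φ) dy = ∫ w φ dy` for all `φ ∈ C²_c` (i.e. `div(A∇u) = w` in distributions),
then `∫ ⟨u⟩ div(ᵗA ∇φ) dy = ∫ ⟨w⟩ φ dy` for all `φ ∈ C²_c`
(i.e. `div(A∇⟨u⟩) = ⟨div(A∇u)⟩` in distributions). -/
theorem average_commutes_with_second_order_operator
    (m : ℕ) (hm : 1 ≤ m)
    (b : (Fin m → ℝ) → (Fin m → ℝ)) (hb : ContDiff ℝ 1 b)
    (C : ℝ) (hC : 0 < C) (hgrow : ∀ y, ‖b y‖ ≤ C * (1 + ‖y‖))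
    (hdivb : ∀ y, ∑ i, fderiv ℝ (fun z => b z i) y (Pi.single i (1:ℝ)) = 0)
    (Y : ℝ → (Fin m → ℝ) → (Fin m → ℝ))
    (hY0 : ∀ y, Y 0 y = y)
    (hYd : ∀ (s : ℝ) (y : Fin m → ℝ), HasDerivAt (fun t => Y t y) (b (Y s y)) s)
    (hYmp : ∀ s : ℝ, MeasurePreserving (Y s) (volume : Measure (Fin m → ℝ)) volume)
    (K : Submodule ℝ (Lp ℝ 2 (volume : Measure (Fin m → ℝ))))
    (hK : ∀ v : Lp ℝ 2 (volume : Measure (Fin m → ℝ)),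
      v ∈ K ↔ ∀ s : ℝ, (fun y => v (Y s y)) =ᵐ[(volume : Measure (Fin m → ℝ))] v)
    (A : (Fin m → ℝ) → Matrix (Fin m) (Fin m) ℝ)
    (hA : ∀ i j, ContDiff ℝ 1 (fun y => A y i j))
    (hbA : ∀ y, (Matrix.of fun i j => fderiv ℝ (fun z => A z i j) y (b y))
        - (Matrix.of fun i j => fderiv ℝ (fun z => b z i) y (Pi.single j (1:ℝ))) * A y
        - A y * ((Matrix.of fun i j => fderiv ℝ (fun z => b z i) y (Pi.single j (1:ℝ)))ᵀ)
        = 0)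
    (u w : Lp ℝ 2 (volume : Measure (Fin m → ℝ)))
    (huw : ∀ φ : (Fin m → ℝ) → ℝ, ContDiff ℝ 2 φ → HasCompactSupport φ →
      ∫ y, u y * (∑ i, fderiv ℝ
          (fun z => ∑ j, A z j i * fderiv ℝ φ z (Pi.single j (1:ℝ))) y
          (Pi.single i (1:ℝ))) ∂(volume : Measure (Fin m → ℝ))
        = ∫ y, w y * φ y ∂(volume : Measure (Fin m → ℝ)))
    (Pu Pw : Lp ℝ 2 (volume : Measure (Fin m → ℝ)))
    (hPuK : Pu ∈ K)
    (hPu : ∀ φ ∈ K, ∫ y, (u y - Pu y) * φ y ∂(volume : Measure (Fin m → ℝ)) = 0)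
    (hPwK : Pw ∈ K)
    (hPw : ∀ φ ∈ K, ∫ y, (w y - Pw y) * φ y ∂(volume : Measure (Fin m → ℝ)) = 0) :
    ∀ φ : (Fin m → ℝ) → ℝ, ContDiff ℝ 2 φ → HasCompactSupport φ →
      ∫ y, Pu y * (∑ i, fderiv ℝ
          (fun z => ∑ j, A z j i * fderiv ℝ φ z (Pi.single j (1:ℝ))) y
          (Pi.single i (1:ℝ))) ∂(volume : Measure (Fin m → ℝ))
        = ∫ y, Pw y * φ y ∂(volume : Measure (Fin m → ℝ)) := by
  intro φ₀ hφ₀ hφ₀c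
  let H := Lp ℝ 2 (volume : Measure (Fin m → ℝ))
  have hinnerH : ∀ f g : H, inner ℝ f g = ∫ y, f y * g y := by
    intro f g
    rw [L2.inner_def]
    congr 1; ext y; simp [mul_comm]
  have hint : ∀ f g : H, Integrable (fun y => f y * g y) volume := fun f g =>
    (Lp.memLp f).integrable_mul (Lp.memLp g)
  -- group of composition operators
  let U : ℝ → H → H := fun s v => Lp.compMeasurePreserving (Y s) (hYmp s) v
  have hU : ∀ s v, U s v =ᵐ[volume] fun y => v (Y s y) := fun s v =>
    Lp.coeFn_compMeasurePreserving v (hYmp s)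
  have hY1 := fun T => aux_flow_C1 b hb C hC.le hgrow Y hY0 hYd T
  have hinv : ∀ s y, Y (-s) (Y s y) = y := fun s y => by
    rw [aux_group b hb Y hY0 hYd, neg_add_cancel, hY0]
  have hinv' : ∀ s y, Y s (Y (-s) y) = y := fun s y => by simpa using hinv (-s) y
  have hUadj : ∀ s (f g : H), inner ℝ (U s f) g = inner ℝ f (U (-s) g) := by
    intro s f g
    rw [hinnerH, hinnerH]
    let e : (Fin m → ℝ) ≃ₜ (Fin m → ℝ) :=
      { toFun := Y s, invFun := Y (-s), left_inv := hinv s, right_inv := hinv' s,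
        continuous_toFun := (hY1 s).continuous, continuous_invFun := (hY1 (-s)).continuous }
    have h1 := (hYmp s).integral_comp e.measurableEmbedding (fun y => f y * g (Y (-s) y))
    simp only [hinv] at h1
    rw [integral_congr_ae (g := fun y => f (Y s y) * g y), h1]
    · refine integral_congr_ae ?_
      filter_upwards [hU (-s) g] with y hy
      rw [hy]
    · filter_upwards [hU s f] with y hy
      rw [hy]
  have hfix : ∀ v : H, v ∈ K ↔ ∀ s, U s v = v := by
    intro v
    rw [hK]
    refine forall_congr' fun s => ?_
    constructor
    · intro h
      exact Lp.ext ((hU s v).trans h)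
    · intro h
      have := hU s v
      rw [h] at this
      exact this.symm
  -- product space
  let V : ℝ → WithLp 2 (H × H) → WithLp 2 (H × H) := fun s p =>
    WithLp.toLp 2 (U s p.fst, U s p.snd)
  have hm1 : ∀ φ : (Fin m → ℝ) → ℝ, ContDiff ℝ 2 φ → HasCompactSupport φ →
      MemLp (auxL A φ) 2 (volume : Measure (Fin m → ℝ)) := fun φ h hc =>
    (auxL_cont A hA φ h).memLp_of_hasCompactSupport (auxL_cs A φ hc)
  have hm2 : ∀ φ : (Fin m → ℝ) → ℝ, ContDiff ℝ 2 φ → HasCompactSupport φ →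
      MemLp φ 2 (volume : Measure (Fin m → ℝ)) := fun φ h hc =>
    h.continuous.memLp_of_hasCompactSupport hc
  let S : Set (WithLp 2 (H × H)) := {p | ∃ (φ : (Fin m → ℝ) → ℝ) (h : ContDiff ℝ 2 φ)
    (hc : HasCompactSupport φ), p = WithLp.toLp 2 ((hm1 φ h hc).toLp _, -(hm2 φ h hc).toLp _)}
  have hSmem : ∀ q : WithLp 2 (H × H), (∀ p ∈ S, inner ℝ p q = 0) ↔
      ∀ φ : (Fin m → ℝ) → ℝ, ContDiff ℝ 2 φ → HasCompactSupport φ →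
        ∫ y, q.fst y * auxL A φ y = ∫ y, q.snd y * φ y := by
    intro q
    have key : ∀ (φ : (Fin m → ℝ) → ℝ) (h : ContDiff ℝ 2 φ) (hc : HasCompactSupport φ),
        inner ℝ (WithLp.toLp 2 ((hm1 φ h hc).toLp _, -(hm2 φ h hc).toLp _) : WithLp 2 (H × H)) q =
        (∫ y, q.fst y * auxL A φ y) - ∫ y, q.snd y * φ y := by
      intro φ h hc
      rw [WithLp.prod_inner_apply]
      change inner ℝ ((hm1 φ h hc).toLp _ : H) q.fst + inner ℝ (-(hm2 φ h hc).toLp _ : H) q.snd = _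
      rw [inner_neg_left, hinnerH, hinnerH, ← sub_eq_add_neg]
      congr 1
      · refine integral_congr_ae ?_
        filter_upwards [(hm1 φ h hc).coeFn_toLp] with y hy
        rw [hy, mul_comm]
      · refine integral_congr_ae ?_
        filter_upwards [(hm2 φ h hc).coeFn_toLp] with y hy
        rw [hy, mul_comm]
    constructor
    · intro hq φ h hc
      have := hq _ ⟨φ, h, hc, rfl⟩
      rw [key φ h hc] at this
      linarith
    · rintro hq p ⟨φ, h, hc, rfl⟩
      rw [key φ h hc, hq φ h hc, sub_self]
  have hloc : ∀ v : H, LocallyIntegrable v volume := fun v =>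
    (Lp.memLp v).locallyIntegrable (by norm_num)
  have main := aux_hilbert V
    (by
      intro s x y
      have h1 : ∀ a b : H, U s (a + b) = U s a + U s b := fun a b => map_add _ a b
      change WithLp.toLp 2 (U s (x.fst + y.fst), U s (x.snd + y.snd)) = _
      rw [h1, h1]; rfl)
    (by
      intro s x y
      rw [WithLp.prod_inner_apply, WithLp.prod_inner_apply]
      change inner ℝ (U s x.fst) y.fst + inner ℝ (U s x.snd) y.snd =
        inner ℝ x.fst (U (-s) y.fst) + inner ℝ x.snd (U (-s) y.snd)
      rw [hUadj, hUadj])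
    S
    (by
      intro x hx s
      rw [hSmem] at hx ⊢
      intro φ h hc
      have := aux_inv b hb C hC hgrow Y hY0 hYd hYmp A hA hbA x.fst x.snd (hloc _) (hloc _) hx s
        φ h hc
      change ∫ y, U s x.fst y * auxL A φ y = ∫ y, U s x.snd y * φ y
      rw [integral_congr_ae (g := fun y => x.fst (Y s y) * auxL A φ y), this]
      · refine integral_congr_ae ?_
        filter_upwards [hU s x.snd] with y hy
        rw [hy]
      · filter_upwards [hU s x.fst] with y hy
        rw [hy])
    (WithLp.toLp 2 (u, w)) (WithLp.toLp 2 (Pu, Pw))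
    ((hSmem _).2 huw)
    (by
      intro s
      change WithLp.toLp 2 (U s Pu, U s Pw) = _
      rw [(hfix Pu).1 hPuK s, (hfix Pw).1 hPwK s])
    (by
      intro g hg
      have h1 : g.fst ∈ K := (hfix _).2 fun s => congrArg WithLp.fst (hg s)
      have h2 : g.snd ∈ K := (hfix _).2 fun s => congrArg WithLp.snd (hg s)
      rw [WithLp.prod_inner_apply]
      change inner ℝ (u - Pu) g.fst + inner ℝ (w - Pw) g.snd = 0
      rw [hinnerH, hinnerH, integral_congr_ae (g := fun y => (u y - Pu y) * g.fst y), hPu _ h1,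
        integral_congr_ae (g := fun y => (w y - Pw y) * g.snd y), hPw _ h2, add_zero]
      · filter_upwards [Lp.coeFn_sub w Pw] with y hy
        rw [hy]; rfl
      · filter_upwards [Lp.coeFn_sub u Pu] with y hy
        rw [hy]; rfl)
  exact (hSmem _).1 main φ₀ hφ₀ hφ₀c
end

section
/- Let A : ℝ^m → M_m(ℝ) be a measurable matrix field with ∫_{ℝ^m} Q(y)A(y) : A(y)Q(y) dy < +∞. Then for every s ∈ ℝ the matrix field (G(s)A)(y) := (∂_yY(s;y))⁻¹ A(Y(s;y)) ᵗ(∂_yY(s;y))⁻¹ satisfies ∫_{ℝ^m} Q (G(s)A) : (G(s)A) Q dy = ∫_{ℝ^m} Q A : A Q dy, and moreover G(s)(G(t)A) = G(s+t)A for all s, t ∈ ℝ. -/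
open MeasureTheory Matrix

/-- Frobenius product of two matrices: `A : B = Σ_{ij} A_{ij} B_{ij}`. -/
def matFrob {m : ℕ} (A B : Matrix (Fin m) (Fin m) ℝ) : ℝ := ∑ i, ∑ j, A i j * B i j

/-- The action `(G(s)A)(y) = (∂_yY(s;y))⁻¹ A(Y(s;y)) ᵗ(∂_yY(s;y))⁻¹` on matrix fields. -/
noncomputable def Gflow (m : ℕ) (Y : ℝ → (Fin m → ℝ) → (Fin m → ℝ))
    (A : (Fin m → ℝ) → Matrix (Fin m) (Fin m) ℝ) (s : ℝ) (y : Fin m → ℝ) :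
    Matrix (Fin m) (Fin m) ℝ :=
  ((Matrix.of fun i j => fderiv ℝ (fun z => Y s z i) y (Pi.single j (1:ℝ)) :
      Matrix (Fin m) (Fin m) ℝ))⁻¹ * A (Y s y) *
    (((Matrix.of fun i j => fderiv ℝ (fun z => Y s z i) y (Pi.single j (1:ℝ)) :
      Matrix (Fin m) (Fin m) ℝ))ᵀ)⁻¹

theorem aux_frob_trace {m : ℕ} (A B : Matrix (Fin m) (Fin m) ℝ) :
    matFrob A B = (Aᵀ * B).trace := by
  simp only [matFrob, Matrix.trace, Matrix.diag, Matrix.mul_apply, Matrix.transpose_apply]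
  exact Finset.sum_comm

theorem aux_frob {m : ℕ} (J P X : Matrix (Fin m) (Fin m) ℝ) (hJ : IsUnit J.det) :
    matFrob (P⁻¹ * (J⁻¹ * X * (Jᵀ)⁻¹)) ((J⁻¹ * X * (Jᵀ)⁻¹) * P⁻¹)
      = matFrob ((J * P * Jᵀ)⁻¹ * X) (X * (J * P * Jᵀ)⁻¹) := by
  have hJt : IsUnit (Jᵀ).det := by rwa [Matrix.det_transpose]
  rw [aux_frob_trace, aux_frob_trace, Matrix.mul_inv_rev, Matrix.mul_inv_rev]
  simp only [Matrix.transpose_mul, Matrix.transpose_nonsing_inv, Matrix.transpose_transpose]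
  rw [Matrix.trace_mul_comm, Matrix.trace_mul_comm (Xᵀ * _)]
  simp only [Matrix.mul_assoc]
  rw [Matrix.trace_mul_comm]
  rw [Matrix.trace_mul_comm X]
  simp only [Matrix.mul_assoc]
  rw [Matrix.trace_mul_comm, Matrix.trace_mul_comm (Jᵀ)⁻¹]
  simp only [Matrix.mul_assoc]
  rw [Matrix.trace_mul_comm]
  simp only [Matrix.mul_assoc]

theorem aux_flow {m : ℕ} (b : (Fin m → ℝ) → (Fin m → ℝ)) (hb : ContDiff ℝ 1 b)
    (f g : ℝ → (Fin m → ℝ)) (hf : ∀ t, HasDerivAt f (b (f t)) t)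
    (hg : ∀ t, HasDerivAt g (b (g t)) t) (h0 : f 0 = g 0) : f = g := by
  funext t
  set T := |t| + 1 with hT
  have hcf : Continuous f := continuous_iff_continuousAt.2 fun t => (hf t).continuousAt
  have hcg : Continuous g := continuous_iff_continuousAt.2 fun t => (hg t).continuousAt
  have hK : IsCompact (f '' Set.Icc (-T) T ∪ g '' Set.Icc (-T) T) :=
    (isCompact_Icc.image hcf).union (isCompact_Icc.image hcg)
  obtain ⟨R, hR⟩ := hK.isBounded.subset_closedBall 0
  obtain ⟨K, hKL⟩ := (hb.contDiffOn (s := Metric.closedBall 0 R)).exists_lipschitzOnWith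
    one_ne_zero (convex_closedBall _ _) (isCompact_closedBall _ _)
  have habs := abs_nonneg t
  have h1 := le_abs_self t
  have h2 := neg_abs_le t
  refine ODE_solution_unique_of_mem_Ioo (v := fun _ => b) (s := fun _ => Metric.closedBall 0 R)
    (K := K) (a := -T) (b := T) (t₀ := 0) (fun _ _ => hKL) ⟨by linarith, by linarith⟩
    (fun u hu => ⟨hf u, hR (Or.inl ⟨u, Set.Ioo_subset_Icc_self hu, rfl⟩)⟩)
    (fun u hu => ⟨hg u, hR (Or.inr ⟨u, Set.Ioo_subset_Icc_self hu, rfl⟩)⟩) h0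
    ⟨by linarith, by linarith⟩

theorem aux_jac_s13 {m : ℕ} (F : (Fin m → ℝ) → (Fin m → ℝ)) (y : Fin m → ℝ)
    (hF : DifferentiableAt ℝ F y) :
    (Matrix.of fun i j => fderiv ℝ (fun z => F z i) y (Pi.single j (1:ℝ)) :
      Matrix (Fin m) (Fin m) ℝ) = LinearMap.toMatrix' (fderiv ℝ F y : (Fin m → ℝ) →ₗ[ℝ] _) := by
  ext i j
  rw [Matrix.of_apply, fderiv_apply hF i, LinearMap.toMatrix'_apply]
  rfl

/-- With `b` a `C¹` divergence-free vector field with linear growth and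
measure-preserving flow `Y` with invertible Jacobians, and `P` a measurable field of
symmetric positive definite matrices, locally square integrable together with `P⁻¹`,
transported by the flow (`P(Y(s;y)) = ∂_yY(s;y) P(y) ᵗ∂_yY(s;y)` a.e.), set `Q = P⁻¹`.
For any measurable matrix field `A` with `∫ QA : AQ dy < ∞`, the field `G(s)A` satisfies
`∫ Q(G(s)A) : (G(s)A)Q dy = ∫ QA : AQ dy` for every `s`, and `G(s)(G(t)A) = G(s+t)A`. -/
theorem Gflow_unitary_group
    (m : ℕ) (hm : 1 ≤ m)
    (b : (Fin m → ℝ) → (Fin m → ℝ)) (hb : ContDiff ℝ 1 b)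
    (C : ℝ) (hC : 0 < C) (hgrow : ∀ y, ‖b y‖ ≤ C * (1 + ‖y‖))
    (hdivb : ∀ y, ∑ i, fderiv ℝ (fun z => b z i) y (Pi.single i (1:ℝ)) = 0)
    (Y : ℝ → (Fin m → ℝ) → (Fin m → ℝ))
    (hY0 : ∀ y, Y 0 y = y)
    (hYd : ∀ (s : ℝ) (y : Fin m → ℝ), HasDerivAt (fun t => Y t y) (b (Y s y)) s)
    (hYs : ∀ s : ℝ, ContDiff ℝ 1 (Y s))
    (hYinv : ∀ (s : ℝ) (y : Fin m → ℝ),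
      IsUnit ((Matrix.of fun i j => fderiv ℝ (fun z => Y s z i) y (Pi.single j (1:ℝ)) :
        Matrix (Fin m) (Fin m) ℝ)).det)
    (hYmp : ∀ s : ℝ, MeasurePreserving (Y s) (volume : Measure (Fin m → ℝ)) volume)
    (P : (Fin m → ℝ) → Matrix (Fin m) (Fin m) ℝ)
    (hPmeas : ∀ i j, Measurable (fun y => P y i j))
    (hPpos : ∀ y, (P y).PosDef)
    (hPloc : ∀ Kc : Set (Fin m → ℝ), IsCompact Kc →
      IntegrableOn (fun y => matFrob (P y) (P y)) Kc (volume : Measure (Fin m → ℝ)) ∧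
      IntegrableOn (fun y => matFrob ((P y)⁻¹) ((P y)⁻¹)) Kc (volume : Measure (Fin m → ℝ)))
    (hPinv : ∀ s : ℝ, ∀ᵐ y ∂(volume : Measure (Fin m → ℝ)),
      P (Y s y)
        = (Matrix.of fun i j => fderiv ℝ (fun z => Y s z i) y (Pi.single j (1:ℝ))) * P y *
          ((Matrix.of fun i j => fderiv ℝ (fun z => Y s z i) y (Pi.single j (1:ℝ)))ᵀ))
    (A : (Fin m → ℝ) → Matrix (Fin m) (Fin m) ℝ)
    (hAmeas : ∀ i j, Measurable (fun y => A y i j))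
    (hAint : Integrable (fun y => matFrob ((P y)⁻¹ * A y) (A y * (P y)⁻¹))
      (volume : Measure (Fin m → ℝ))) :
    (∀ s : ℝ,
      ∫ y, matFrob ((P y)⁻¹ * Gflow m Y A s y) (Gflow m Y A s y * (P y)⁻¹)
          ∂(volume : Measure (Fin m → ℝ))
        = ∫ y, matFrob ((P y)⁻¹ * A y) (A y * (P y)⁻¹)
            ∂(volume : Measure (Fin m → ℝ))) ∧
    (∀ (s t : ℝ) (y : Fin m → ℝ),
      Gflow m Y (fun z => Gflow m Y A t z) s y = Gflow m Y A (s + t) y) := by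
  refine ⟨fun s => ?_, fun s t y => ?_⟩
  · have hmp := hYmp s
    have hm2 : AEStronglyMeasurable (fun y => matFrob ((P y)⁻¹ * A y) (A y * (P y)⁻¹))
        (Measure.map (Y s) volume) := by
      rw [hmp.map_eq]; exact hAint.aestronglyMeasurable
    have h := integral_map hmp.measurable.aemeasurable hm2
    rw [hmp.map_eq] at h
    rw [h]
    refine integral_congr_ae ?_
    filter_upwards [hPinv s] with y hy
    simp only [Gflow]
    rw [hy]
    exact aux_frob _ _ _ (hYinv s y)
  · have hfl : ∀ z, Y t (Y s z) = Y (s + t) z := by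
      intro z
      have := aux_flow b hb (fun u => Y u (Y s z)) (fun u => Y (s + u) z)
        (fun u => hYd u _) (fun u => (hYd (s + u) z).comp_const_add s u) (by simp [hY0])
      exact congrFun this t
    have hd : ∀ u, Differentiable ℝ (Y u) := fun u => (hYs u).differentiable one_ne_zero
    have hJ : (Matrix.of fun i j => fderiv ℝ (fun z => Y (s + t) z i) y (Pi.single j (1:ℝ)) :
        Matrix (Fin m) (Fin m) ℝ) =
        (Matrix.of fun i j => fderiv ℝ (fun z => Y t z i) (Y s y) (Pi.single j (1:ℝ))) *
        (Matrix.of fun i j => fderiv ℝ (fun z => Y s z i) y (Pi.single j (1:ℝ))) := by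
      rw [aux_jac_s13 _ _ (hd _ _), aux_jac_s13 _ _ (hd _ _), aux_jac_s13 _ _ (hd _ _),
        ← LinearMap.toMatrix'_comp]
      have : Y (s + t) = Y t ∘ Y s := funext fun z => (hfl z).symm
      rw [this, fderiv_comp y (hd t _) (hd s y)]
      rfl
    simp only [Gflow]
    rw [hJ, hfl, Matrix.transpose_mul, Matrix.mul_inv_rev, Matrix.mul_inv_rev]
    simp only [Matrix.mul_assoc]
end

section
/- An element x ∈ H belongs to dom L if and only if there exists a constant C > 0 such that ‖G(s)x − x‖ ≤ C|s| for every s ∈ ℝ. -/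
open Filter Topology

lemma weak_limit_aux {H : Type*} [NormedAddCommGroup H] [InnerProductSpace ℝ H] [CompleteSpace H]
    (U : Ultrafilter ℝ) (f : ℝ → H) (C : ℝ) (hf : ∀ s, ‖f s‖ ≤ C) :
    ∃ l : H, ∀ y : H, Tendsto (fun s => inner ℝ (f s) y) U (𝓝 (inner ℝ l y)) := by
  have hc := WeakDual.isCompact_closedBall (𝕜 := ℝ) (E := H) 0 C
  let g : ℝ → WeakDual ℝ H := fun s => StrongDual.toWeakDual (InnerProductSpace.toDual ℝ H (f s))
  have hg : ∀ s, g s ∈ WeakDual.toStrongDual ⁻¹' Metric.closedBall (0 : StrongDual ℝ H) C := by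
    intro s
    have h1 : WeakDual.toStrongDual (g s) = InnerProductSpace.toDual ℝ H (f s) := rfl
    simp only [Set.mem_preimage, h1, mem_closedBall_zero_iff, LinearIsometryEquiv.norm_map]
    exact hf s
  obtain ⟨w, -, hw⟩ := hc.ultrafilter_le_nhds (U.map g)
    (by rw [le_principal_iff]; exact Filter.mem_map.mpr (Filter.univ_mem' hg))
  refine ⟨(InnerProductSpace.toDual ℝ H).symm (WeakDual.toStrongDual w), fun y => ?_⟩
  have h2 : Tendsto g U (𝓝 w) := hw
  have h3 := ((WeakDual.eval_continuous y).tendsto w).comp h2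
  rw [InnerProductSpace.toDual_symm_apply]
  exact h3


open Filter Topology

/-- Let `(G(s))_{s∈ℝ}` be a strongly continuous one-parameter group of
unitary operators on a real Hilbert space `H` with infinitesimal generator `L`, encoded by
the relation `IsGen x l ↔ (G(s)x − x)/s → l as s → 0`.  Then `x ∈ dom L` iff there is a
constant `C > 0` with `‖G(s)x − x‖ ≤ C |s|` for every `s ∈ ℝ`. -/
theorem mem_domain_generator_iff_lipschitz_orbit
    {H : Type*} [NormedAddCommGroup H] [InnerProductSpace ℝ H] [CompleteSpace H]
    (G : ℝ → H →L[ℝ] H)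
    (hG0 : ∀ x : H, G 0 x = x)
    (hGgroup : ∀ (s t : ℝ) (x : H), G s (G t x) = G (s + t) x)
    (hGiso : ∀ (s : ℝ) (x : H), ‖G s x‖ = ‖x‖)
    (hGsurj : ∀ s : ℝ, Function.Surjective (G s))
    (hGcont : ∀ x : H, Continuous fun s : ℝ => G s x)
    (IsGen : H → H → Prop)
    (hIsGen : ∀ x l : H, IsGen x l ↔
      Tendsto (fun s : ℝ => (1 / s) • (G s x - x)) (nhdsWithin 0 {0}ᶜ) (nhds l))
    (x : H) :
    (∃ l, IsGen x l) ↔ (∃ C : ℝ, 0 < C ∧ ∀ s : ℝ, ‖G s x - x‖ ≤ C * |s|) := by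
  have hF : ∀ v : H, ∀ t : ℝ, HasDerivAt (fun u => ∫ r in (0:ℝ)..u, G r v) (G t v) t := fun v t =>
    intervalIntegral.integral_hasDerivAt_right ((hGcont v).intervalIntegrable _ _)
      ((hGcont v).stronglyMeasurableAtFilter _ _) (hGcont v).continuousAt
  constructor
  · rintro ⟨l, hl⟩
    rw [hIsGen] at hl
    have h1 : ∀ᶠ s in 𝓝[≠] (0:ℝ), ‖(1 / s) • (G s x - x)‖ < ‖l‖ + 1 :=
      hl.norm.eventually_lt_const (by linarith)
    rw [eventually_nhdsWithin_iff, Metric.eventually_nhds_iff] at h1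
    obtain ⟨δ, hδ, h1⟩ := h1
    have hp : 0 ≤ 2 * ‖x‖ / δ := by positivity
    refine ⟨‖l‖ + 1 + 2 * ‖x‖ / δ, by positivity, fun s => ?_⟩
    rcases eq_or_ne s 0 with rfl | hs
    · simp [hG0]
    have hs' : 0 < |s| := abs_pos.mpr hs
    by_cases hsd : |s| < δ
    · have h2 := h1 (y := s) (by simpa using hsd) hs
      rw [norm_smul, norm_div, norm_one, Real.norm_eq_abs, one_div, inv_mul_lt_iff₀ hs'] at h2
      nlinarith
    · push Not at hsd
      have h2 : ‖G s x - x‖ ≤ 2 * ‖x‖ := by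
        have := norm_sub_le (G s x) x
        rw [hGiso] at this
        linarith
      have h3 : 2 * ‖x‖ ≤ 2 * ‖x‖ / δ * |s| := by
        rw [div_mul_eq_mul_div, le_div_iff₀ hδ]
        gcongr
      have := mul_nonneg (add_nonneg (norm_nonneg l) zero_le_one) hs'.le
      nlinarith
  · rintro ⟨C, hC, hx⟩
    let U : Ultrafilter ℝ := Ultrafilter.of (𝓝[≠] (0:ℝ))
    have hU : (U : Filter ℝ) ≤ 𝓝[≠] (0:ℝ) := Ultrafilter.of_le _
    obtain ⟨l, hl⟩ := weak_limit_aux U (fun s => s⁻¹ • (G s x - x)) C (by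
      intro s
      rcases eq_or_ne s 0 with rfl | hs
      · simp [hC.le]
      · have hs' : 0 < |s| := abs_pos.mpr hs
        rw [norm_smul, norm_inv, Real.norm_eq_abs, inv_mul_le_iff₀ hs', mul_comm]
        exact hx s)
    have key : ∀ t : ℝ, G t x - x = ∫ r in (0:ℝ)..t, G r l := by
      intro t
      let T : H →L[ℝ] H := LinearMap.mkContinuous
        { toFun := fun v => ∫ r in (0:ℝ)..t, G r v
          map_add' := fun v w => by
            simp only [map_add]
            exact intervalIntegral.integral_add ((hGcont v).intervalIntegrable _ _)
              ((hGcont w).intervalIntegrable _ _)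
          map_smul' := fun c v => by
            simp only [map_smul, RingHom.id_apply]
            exact intervalIntegral.integral_smul _ _ } |t| (fun v => by
          have := intervalIntegral.norm_integral_le_of_norm_le_const (a := (0:ℝ)) (b := t)
            (f := fun r => G r v) (C := ‖v‖) (fun r _ => (hGiso r v).le)
          rw [sub_zero, mul_comm] at this
          exact this)
      have hT : ∀ v, T v = ∫ r in (0:ℝ)..t, G r v := fun v => rfl
      have hTA : ∀ h : ℝ, T (h⁻¹ • (G h x - x)) =
          h⁻¹ • ((∫ r in (0:ℝ)..(t + h), G r x) - ∫ r in (0:ℝ)..t, G r x)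
          - h⁻¹ • ((∫ r in (0:ℝ)..(0 + h), G r x) - ∫ r in (0:ℝ)..0, G r x) := by
        intro h
        rw [map_smul, map_sub, hT, hT, ← smul_sub]
        congr 1
        simp only [hGgroup]
        rw [intervalIntegral.integral_comp_add_right (fun r => G r x) h,
          ← intervalIntegral.integral_interval_sub_left
            ((hGcont x).intervalIntegrable 0 (t + h)) ((hGcont x).intervalIntegrable 0 (0 + h)),
          intervalIntegral.integral_same]
        abel
      have hlim : Tendsto (fun h : ℝ => T (h⁻¹ • (G h x - x))) (𝓝[≠] 0) (𝓝 (G t x - x)) := by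
        simp only [hTA]
        have := (hF x t).tendsto_slope_zero.sub (hF x 0).tendsto_slope_zero
        rwa [hG0] at this
      rw [← hT]
      refine ext_inner_right ℝ fun y => ?_
      have h1 : Tendsto (fun h : ℝ => inner ℝ (T (h⁻¹ • (G h x - x))) y) U
          (𝓝 (inner ℝ (G t x - x) y)) := (hlim.mono_left hU).inner tendsto_const_nhds
      have h2 := hl (ContinuousLinearMap.adjoint T y)
      simp only [ContinuousLinearMap.adjoint_inner_right] at h2
      exact tendsto_nhds_unique h1 h2
    refine ⟨l, (hIsGen x l).mpr ?_⟩
    have h := (hF l 0).tendsto_slope_zero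
    simp only [hG0, zero_add, intervalIntegral.integral_same, sub_zero] at h
    simpa only [key, one_div] using h
end

section
/- Let U and V be real symmetric m×m matrices and let R be an orthogonal m×m matrix. Then (ᵗR U⁺ R − V⁺) : (ᵗR U⁺ R − V⁺) ≤ (ᵗR U R − V) : (ᵗR U R − V), and likewise (ᵗR U⁻ R − V⁻) : (ᵗR U⁻ R − V⁻) ≤ (ᵗR U R − V) : (ᵗR U R − V). -/
open Matrix

theorem trace_mul_psd_nonneg_aux {m : ℕ} {A D : Matrix (Fin m) (Fin m) ℝ}
    (hA : A.PosSemidef) (hD : D.PosSemidef) : 0 ≤ (A * D).trace := by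
  obtain ⟨X, rfl⟩ : ∃ X : Matrix (Fin m) (Fin m) ℝ, A = Xᴴ * X := by
    open scoped MatrixOrder in
    exact CStarAlgebra.nonneg_iff_eq_star_mul_self.mp hA.nonneg
  rw [Matrix.mul_assoc, Matrix.trace_mul_comm]
  exact (hD.mul_mul_conjTranspose_same X).trace_nonneg

theorem contraction_aux {m : ℕ} {A B C D : Matrix (Fin m) (Fin m) ℝ}
    (hA : A.PosSemidef) (hB : B.PosSemidef) (hC : C.PosSemidef) (hD : D.PosSemidef)
    (hAB : A * B = 0) (hCD : C * D = 0) :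
    ((A - C)ᵀ * (A - C)).trace ≤ (((A - B) - (C - D))ᵀ * ((A - B) - (C - D))).trace ∧
    ((B - D)ᵀ * (B - D)).trace ≤ (((A - B) - (C - D))ᵀ * ((A - B) - (C - D))).trace := by
  have h1 := trace_mul_psd_nonneg_aux hA hD
  have h2 := trace_mul_psd_nonneg_aux hC hB
  have n1 : 0 ≤ ((A - C)ᵀ * (A - C)).trace := by
    simpa using (Matrix.posSemidef_conjTranspose_mul_self (A - C)).trace_nonneg
  have n2 : 0 ≤ ((B - D)ᵀ * (B - D)).trace := by
    simpa using (Matrix.posSemidef_conjTranspose_mul_self (B - D)).trace_nonneg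
  have tA : Aᵀ = A := by simpa using hA.isHermitian.eq
  have tB : Bᵀ = B := by simpa using hB.isHermitian.eq
  have tC : Cᵀ = C := by simpa using hC.isHermitian.eq
  have tD : Dᵀ = D := by simpa using hD.isHermitian.eq
  have key : (((A - B) - (C - D))ᵀ * ((A - B) - (C - D))).trace
      = ((A - C)ᵀ * (A - C)).trace + ((B - D)ᵀ * (B - D)).trace
        + 2 * (A * D).trace + 2 * (C * B).trace := by
    have e1 : (A * B).trace = 0 := by simp [hAB]
    have e2 : (C * D).trace = 0 := by simp [hCD]
    simp only [Matrix.transpose_sub, tA, tB, tC, tD, Matrix.sub_mul, Matrix.mul_sub,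
      Matrix.trace_sub]
    rw [Matrix.trace_mul_comm B A, Matrix.trace_mul_comm D C, Matrix.trace_mul_comm D A,
      Matrix.trace_mul_comm B C]
    linarith [Matrix.trace_mul_comm D B, Matrix.trace_mul_comm A C]
  constructor <;> linarith

/-- Let `U`, `V` be real symmetric `m×m` matrices with positive/negative
parts `U⁺, U⁻` and `V⁺, V⁻` (the unique pairs of symmetric positive semidefinite matrices
with `U⁺ − U⁻ = U`, `U⁺U⁻ = 0`, and similarly for `V`), and let `R` be orthogonal.  Then
`(ᵗR U⁺ R − V⁺) : (ᵗR U⁺ R − V⁺) ≤ (ᵗR U R − V) : (ᵗR U R − V)` and likewise for the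
negative parts, where `A : B = Σ_{ij} A_{ij} B_{ij} = trace(ᵗA B)`. -/
theorem orthogonal_conjugation_positive_part_contraction
    (m : ℕ) (hm : 1 ≤ m)
    (U Up Un V Vp Vn R : Matrix (Fin m) (Fin m) ℝ)
    (hUp : Up.PosSemidef) (hUn : Un.PosSemidef) (hUdec : Up - Un = U) (hUo : Up * Un = 0)
    (hVp : Vp.PosSemidef) (hVn : Vn.PosSemidef) (hVdec : Vp - Vn = V) (hVo : Vp * Vn = 0)
    (hR : Rᵀ * R = 1) :
    ((Rᵀ * Up * R - Vp)ᵀ * (Rᵀ * Up * R - Vp)).trace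
        ≤ ((Rᵀ * U * R - V)ᵀ * (Rᵀ * U * R - V)).trace ∧
    ((Rᵀ * Un * R - Vn)ᵀ * (Rᵀ * Un * R - Vn)).trace
        ≤ ((Rᵀ * U * R - V)ᵀ * (Rᵀ * U * R - V)).trace := by
  subst hUdec hVdec
  have hR' : R * Rᵀ = 1 := mul_eq_one_comm.mp hR
  have hA : (Rᵀ * Up * R).PosSemidef := by simpa using hUp.conjTranspose_mul_mul_same R
  have hB : (Rᵀ * Un * R).PosSemidef := by simpa using hUn.conjTranspose_mul_mul_same R
  have hAB : (Rᵀ * Up * R) * (Rᵀ * Un * R) = 0 := by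
    calc (Rᵀ * Up * R) * (Rᵀ * Un * R) = Rᵀ * Up * (R * Rᵀ) * Un * R := by
          simp only [Matrix.mul_assoc]
      _ = Rᵀ * (Up * Un) * R := by rw [hR']; simp only [Matrix.mul_assoc, Matrix.one_mul]
      _ = 0 := by simp [hUo]
  have h := contraction_aux hA hB hVp hVn hAB hVo
  rw [Matrix.mul_sub Rᵀ Up Un, Matrix.sub_mul (Rᵀ * Up) (Rᵀ * Un) R]
  exact h
end

section
/- Let D ∈ H and let A : [0,∞) → H be continuous with A(0) = D, such that for every t > 0, A(t) ∈ dom L² := {x ∈ dom L : Lx ∈ dom L}, A is differentiable on (0,∞), and A'(t) = L(L(A(t))) for all t > 0. Then A(t) converges weakly in H, as t → +∞, to the orthogonal projection of D onto ker L. -/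
open Filter Topology

/-- Let `L` be a densely defined skew-adjoint operator on a real Hilbert
space `H` (skew-symmetry plus the maximality property characterizing `dom L* = dom L`,
`L* = −L`), and let `N = ker L`.  If `A : [0,∞) → H` is continuous with `A(0) = D`,
`A(t) ∈ dom L²` for `t > 0`, and `A'(t) = L(L(A(t)))` for `t > 0`, then `A(t)` converges
weakly in `H`, as `t → ∞`, to the orthogonal projection of `D` onto `ker L`. -/
theorem heat_flow_converges_weakly_to_projection
    {H : Type*} [NormedAddCommGroup H] [InnerProductSpace ℝ H] [CompleteSpace H]
    (dom : Submodule ℝ H) (hdense : Dense (dom : Set H))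
    (L : dom →ₗ[ℝ] H)
    (hskew : ∀ u v : dom, inner (𝕜 := ℝ) (L u) (v : H) = - inner (𝕜 := ℝ) (u : H) (L v))
    (hmax : ∀ v w : H, (∀ u : dom, inner (𝕜 := ℝ) (L u) v = inner (𝕜 := ℝ) (u : H) w) →
      ∃ hv : v ∈ dom, w = - L ⟨v, hv⟩)
    (N : Submodule ℝ H)
    (hN : ∀ x : H, x ∈ N ↔ ∃ hx : x ∈ dom, L ⟨x, hx⟩ = 0)
    (D : H) (A : ℝ → H)
    (hAcont : ContinuousOn A (Set.Ici (0:ℝ)))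
    (hA0 : A 0 = D)
    (hAeq : ∀ t : ℝ, 0 < t → ∃ (h₁ : A t ∈ dom) (h₂ : L ⟨A t, h₁⟩ ∈ dom),
      HasDerivAt A (L ⟨L ⟨A t, h₁⟩, h₂⟩) t) :
    ∃ P : H, P ∈ N ∧ (∀ w ∈ N, inner (𝕜 := ℝ) (D - P) w = 0) ∧
      ∀ v : H, Tendsto (fun t : ℝ => inner (𝕜 := ℝ) (A t) v) atTop
        (nhds (inner (𝕜 := ℝ) P v)) := by
  choose h₁ h₂ hd using hAeq
  -- symmetry of L^2
  have hsym : ∀ a b (ha : 0 < a) (hb : 0 < b),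
      inner ℝ (L ⟨L ⟨A a, h₁ a ha⟩, h₂ a ha⟩) (A b)
        = - inner ℝ (L ⟨A a, h₁ a ha⟩) (L ⟨A b, h₁ b hb⟩) := by
    intro a b ha hb
    exact hskew ⟨L ⟨A a, h₁ a ha⟩, h₂ a ha⟩ ⟨A b, h₁ b hb⟩
  have hphi : ∀ a b, 0 < a → 0 < b →
      inner ℝ (A a) (A b) = inner ℝ (A ((a+b)/2)) (A ((a+b)/2)) := by
    intro a b ha hb
    have hder : ∀ x ∈ Set.Ioo 0 (a+b),
        HasDerivAt (fun x => inner ℝ (A x) (A (a+b-x))) 0 x := by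
      intro x hx
      have hx0 : 0 < x := hx.1
      have hy0 : 0 < a+b-x := by linarith [hx.2]
      have e2 : HasDerivAt (fun x => A (a+b-x)) (-(L ⟨L ⟨A (a+b-x), h₁ _ hy0⟩, h₂ _ hy0⟩)) x := by
        have := (hd _ hy0).scomp x ((hasDerivAt_id x).const_sub (a+b))
        simpa [Function.comp_def] using this
      have e3 := (hd x hx0).inner ℝ e2
      refine HasDerivAt.congr_deriv e3 ?_
      rw [inner_neg_right, real_inner_comm _ (A x), hsym _ _ hx0 hy0, hsym _ _ hy0 hx0,
        real_inner_comm]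
      ring
    have := isOpen_Ioo.is_const_of_deriv_eq_zero (isPreconnected_Ioo)
      (fun x hx => (hder x hx).differentiableAt.differentiableWithinAt)
      (fun x hx => (hder x hx).deriv)
      (x := a) (y := (a+b)/2) ⟨ha, by linarith⟩ ⟨by linarith, by linarith⟩
    rwa [show a + b - a = b by ring, show a + b - (a+b)/2 = (a+b)/2 by ring] at this
  have hf : ∀ t (ht : 0 < t), HasDerivAt (fun t => inner ℝ (A t) (A t))
      (-2 * ‖L ⟨A t, h₁ t ht⟩‖^2) t := by
    intro t ht
    refine HasDerivAt.congr_deriv ((hd t ht).inner ℝ (hd t ht)) ?_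
    rw [real_inner_comm _ (A t), hsym t t ht ht, real_inner_self_eq_norm_sq]
    ring
  have hanti : AntitoneOn (fun t => inner ℝ (A t) (A t)) (Set.Ioi (0:ℝ)) := by
    apply antitoneOn_of_deriv_nonpos (convex_Ioi 0)
    · exact fun x hx => (hf x hx).continuousAt.continuousWithinAt
    · intro x hx
      rw [interior_Ioi] at hx
      exact (hf x hx).differentiableAt.differentiableWithinAt
    · intro x hx
      rw [interior_Ioi] at hx
      rw [(hf x hx).deriv]
      nlinarith [sq_nonneg ‖L ⟨A x, h₁ x hx⟩‖]
  obtain ⟨l, hl⟩ : ∃ l, Tendsto (fun t => inner ℝ (A t) (A t)) atTop (𝓝 l) := by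
    have h : Antitone (fun t : ℝ => inner ℝ (A (max t 1)) (A (max t 1))) := by
      intro s t hst
      exact hanti (Set.mem_Ioi.2 (lt_of_lt_of_le one_pos (le_max_right _ _)))
        (Set.mem_Ioi.2 (lt_of_lt_of_le one_pos (le_max_right _ _))) (max_le_max_right 1 hst)
    refine ⟨_, (tendsto_atTop_ciInf h ⟨0, ?_⟩).congr' ?_⟩
    · rintro _ ⟨t, rfl⟩
      exact real_inner_self_nonneg
    · filter_upwards [eventually_ge_atTop 1] with t ht
      rw [max_eq_left ht]
  have hcau : CauchySeq A := by
    rw [Metric.cauchySeq_iff]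
    intro ε hε
    obtain ⟨T, hT⟩ := eventually_atTop.1
      ((Metric.tendsto_nhds.1 hl (ε^2/4) (by positivity)).and (eventually_gt_atTop 0))
    refine ⟨T, fun m hm n hn => ?_⟩
    obtain ⟨m1, m0⟩ := hT m hm
    obtain ⟨n1, n0⟩ := hT n hn
    obtain ⟨k1, k0⟩ := hT ((m+n)/2) (by linarith)
    rw [Real.dist_eq, abs_lt] at m1 n1 k1
    rw [dist_eq_norm]
    apply lt_of_pow_lt_pow_left₀ 2 hε.le
    rw [norm_sub_sq_real, hphi m n m0 n0, ← real_inner_self_eq_norm_sq,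
      ← real_inner_self_eq_norm_sq]
    linarith [m1.2, n1.2, k1.1]
  obtain ⟨P, hP⟩ := cauchySeq_tendsto_of_complete hcau
  -- points where LA is small
  have hmvt : ∀ n : ℕ, ∃ c : ℝ, ∃ hc : 0 < c, (n:ℝ) ≤ c ∧
      -2 * ‖L ⟨A c, h₁ c hc⟩‖^2 = inner ℝ (A ((n:ℝ)+2)) (A ((n:ℝ)+2))
        - inner ℝ (A ((n:ℝ)+1)) (A ((n:ℝ)+1)) := by
    intro n
    have hn : (0:ℝ) ≤ n := Nat.cast_nonneg n
    have hpos : ∀ x ∈ Set.Icc ((n:ℝ)+1) (n+2), 0 < x := fun x hx => by linarith [hx.1]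
    obtain ⟨c, hc, e⟩ := exists_deriv_eq_slope (fun t => inner ℝ (A t) (A t))
      (a := (n:ℝ)+1) (b := n+2) (by linarith)
      (fun x hx => (hf x (hpos x hx)).continuousAt.continuousWithinAt)
      (fun x hx => (hf x (hpos x ⟨hx.1.le, hx.2.le⟩)).differentiableAt.differentiableWithinAt)
    have hc0 := hpos c ⟨hc.1.le, hc.2.le⟩
    refine ⟨c, hc0, by linarith [hc.1], ?_⟩
    rw [(hf c hc0).deriv] at e
    rw [e]
    have : (n:ℝ)+2-(n+1) = 1 := by ring
    rw [this, div_one]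
  choose c hc hnc hce using hmvt
  have hct : Tendsto c atTop atTop := tendsto_atTop_mono hnc tendsto_natCast_atTop_atTop
  have hLA : Tendsto (fun n => L ⟨A (c n), h₁ _ (hc n)⟩) atTop (𝓝 0) := by
    have t1 := hl.comp (tendsto_atTop_add_const_right atTop (1:ℝ)
      (tendsto_natCast_atTop_atTop (R := ℝ)))
    have t2 := hl.comp (tendsto_atTop_add_const_right atTop (2:ℝ)
      (tendsto_natCast_atTop_atTop (R := ℝ)))
    have t3 := ((t1.sub t2).div_const 2).sqrt
    rw [tendsto_zero_iff_norm_tendsto_zero]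
    simp only [sub_self, zero_div, Real.sqrt_zero] at t3
    refine t3.congr fun n => ?_
    have := hce n
    simp only [Function.comp_apply]
    rw [← Real.sqrt_sq (norm_nonneg (L ⟨A (c n), h₁ _ (hc n)⟩))]
    congr 1
    linarith
  have hPN : P ∈ N := by
    rw [hN]
    obtain ⟨hv, h0⟩ := hmax P 0 (by
      intro u
      rw [inner_zero_right]
      have a1 : Tendsto (fun n => inner ℝ (L u) (A (c n))) atTop (𝓝 (inner ℝ (L u) P)) :=
        tendsto_const_nhds.inner (hP.comp hct)
      have a2 : Tendsto (fun n => - inner ℝ (u : H) (L ⟨A (c n), h₁ _ (hc n)⟩)) atTop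
          (𝓝 (- inner ℝ (u : H) (0 : H))) := (tendsto_const_nhds.inner hLA).neg
      rw [inner_zero_right, neg_zero] at a2
      exact tendsto_nhds_unique a1 (a2.congr fun n => (hskew u ⟨A (c n), h₁ _ (hc n)⟩).symm))
    exact ⟨hv, by simpa using h0.symm⟩
  refine ⟨P, hPN, ?_, fun v => hP.inner tendsto_const_nhds⟩
  intro w hw
  obtain ⟨hwd, hw0⟩ := (hN w).1 hw
  have hder : ∀ t, 0 < t → HasDerivAt (fun t => inner ℝ (A t) w) 0 t := by
    intro t ht
    refine HasDerivAt.congr_deriv ((hd t ht).inner ℝ (hasDerivAt_const t w)) ?_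
    have := hskew ⟨L ⟨A t, h₁ t ht⟩, h₂ t ht⟩ ⟨w, hwd⟩
    rw [hw0] at this
    simp only [inner_zero_right, neg_zero] at this
    simp [this]
  have hconst : ∀ t, 0 < t → inner ℝ (A t) w = inner ℝ D w := by
    intro t ht
    obtain ⟨c, hc, e⟩ := exists_hasDerivAt_eq_slope (fun t => inner ℝ (A t) w) (fun _ => 0) ht
      ((hAcont.mono Set.Icc_subset_Ici_self).inner continuousOn_const)
      (fun x hx => hder x hx.1)
    have : inner ℝ (A t) w - inner ℝ (A 0) w = 0 := by
      rcases div_eq_zero_iff.1 e.symm with h | h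
      · exact h
      · linarith
    rw [hA0] at this
    linarith
  have hlim : Tendsto (fun t => inner ℝ (A t) w) atTop (𝓝 (inner ℝ P w)) :=
    hP.inner tendsto_const_nhds
  have hlim2 : Tendsto (fun t => inner ℝ (A t) w) atTop (𝓝 (inner ℝ D w)) :=
    tendsto_const_nhds.congr' (by
      filter_upwards [eventually_gt_atTop 0] with t ht using (hconst t ht).symm)
  rw [inner_sub_left, tendsto_nhds_unique hlim hlim2, sub_self]
end

section
/- Assume in addition that the range of L is a closed subspace of H. Then the range of L² (where dom L² := {x ∈ dom L : Lx ∈ dom L} and L²x = L(Lx)) equals the range of L; consequently, for every D ∈ H there exists a unique F ∈ dom L² with F ∈ (ker L)^⊥ such that L(L(F)) = P_{ker L}D − D, where P_{ker L} denotes the orthogonal projection of H onto ker L. -/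
open Filter Topology

/-- Let `L` be a densely defined skew-adjoint operator on a real Hilbert
space `H` (skew-symmetry plus the maximality property characterizing `dom L* = dom L`,
`L* = −L`), with `N = ker L`, and assume the range of `L` is closed.  Then
`ran L² = ran L`, and for every `D ∈ H` there is a unique `F ∈ dom L²` with `F ∈ Nᗮ` and
`L(L(F)) = P_N D − D`, where `P_N D` is the orthogonal projection of `D` onto `N`
(characterized by `P_N D ∈ N` and `D − P_N D ⊥ N`). -/
theorem closed_range_square_decomposition
    {H : Type*} [NormedAddCommGroup H] [InnerProductSpace ℝ H] [CompleteSpace H]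
    (dom : Submodule ℝ H) (hdense : Dense (dom : Set H))
    (L : dom →ₗ[ℝ] H)
    (hskew : ∀ u v : dom, inner (𝕜 := ℝ) (L u) (v : H) = - inner (𝕜 := ℝ) (u : H) (L v))
    (hmax : ∀ v w : H, (∀ u : dom, inner (𝕜 := ℝ) (L u) v = inner (𝕜 := ℝ) (u : H) w) →
      ∃ hv : v ∈ dom, w = - L ⟨v, hv⟩)
    (N : Submodule ℝ H)
    (hN : ∀ x : H, x ∈ N ↔ ∃ hx : x ∈ dom, L ⟨x, hx⟩ = 0)
    (hclosed : IsClosed {v : H | ∃ u : dom, L u = v}) :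
    -- range L² = range L
    ({v : H | ∃ (x : H) (hx : x ∈ dom) (hx₂ : L ⟨x, hx⟩ ∈ dom), L ⟨L ⟨x, hx⟩, hx₂⟩ = v}
        = {v : H | ∃ u : dom, L u = v}) ∧
    -- existence and uniqueness of F
    (∀ D PD : H, PD ∈ N → (∀ w ∈ N, inner (𝕜 := ℝ) (D - PD) w = 0) →
      (∃ (F : H) (hF : F ∈ dom) (hF₂ : L ⟨F, hF⟩ ∈ dom),
        F ∈ Nᗮ ∧ L ⟨L ⟨F, hF⟩, hF₂⟩ = PD - D) ∧
      (∀ (F₁ F₂ : H) (hF₁ : F₁ ∈ dom) (hF₁₂ : L ⟨F₁, hF₁⟩ ∈ dom)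
          (hF₂ : F₂ ∈ dom) (hF₂₂ : L ⟨F₂, hF₂⟩ ∈ dom),
        F₁ ∈ Nᗮ → F₂ ∈ Nᗮ → L ⟨L ⟨F₁, hF₁⟩, hF₁₂⟩ = PD - D →
        L ⟨L ⟨F₂, hF₂⟩, hF₂₂⟩ = PD - D → F₁ = F₂)) := by
  have hRmem : ∀ x : H, x ∈ LinearMap.range L ↔ ∃ u : dom, L u = x := fun x =>
    LinearMap.mem_range
  have hRc : IsClosed ((LinearMap.range L : Submodule ℝ H) : Set H) := by
    convert hclosed using 1
    ext x
    exact hRmem x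
  have hRN : (LinearMap.range L)ᗮ = N := by
    ext v
    rw [hN, Submodule.mem_orthogonal]
    constructor
    · intro h
      obtain ⟨hv, hw⟩ := hmax v 0 (fun u => by
        rw [h (L u) ⟨u, rfl⟩, inner_zero_right])
      exact ⟨hv, by simpa using hw.symm⟩
    · rintro ⟨hv, h0⟩ _ ⟨u, rfl⟩
      have := hskew u ⟨v, hv⟩
      rw [h0] at this
      simpa using this
  have : CompleteSpace (LinearMap.range L : Submodule ℝ H) := hRc.completeSpace_coe
  have hNR : Nᗮ = LinearMap.range L := by
    rw [← hRN, Submodule.orthogonal_orthogonal]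
  have key : ∀ v : H, v ∈ LinearMap.range L →
      ∃ (r : H) (hr : r ∈ dom), r ∈ LinearMap.range L ∧ L ⟨r, hr⟩ = v := by
    rintro _ ⟨u, rfl⟩
    obtain ⟨r, hr, n, hn, hu⟩ :=
      (LinearMap.range L).exists_add_mem_mem_orthogonal (u : H)
    rw [hRN, hN] at hn
    obtain ⟨hnd, hn0⟩ := hn
    have hre : r = (u : H) - n := by rw [hu]; abel
    have hrd : r ∈ dom := by rw [hre]; exact dom.sub_mem u.2 hnd
    refine ⟨r, hrd, hr, ?_⟩
    have h1 : (⟨r, hrd⟩ : dom) = u - ⟨n, hnd⟩ := Subtype.ext hre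
    rw [h1, map_sub, hn0, sub_zero]
  have key2 : ∀ v : H, v ∈ LinearMap.range L →
      ∃ (F : H) (hF : F ∈ dom) (hF₂ : L ⟨F, hF⟩ ∈ dom),
        F ∈ Nᗮ ∧ L ⟨L ⟨F, hF⟩, hF₂⟩ = v := by
    intro v hv
    obtain ⟨y, hy, hyR, rfl⟩ := key v hv
    obtain ⟨F, hF, hFR, rfl⟩ := key y hyR
    exact ⟨F, hF, hy, hNR ▸ hFR, rfl⟩
  have disj : ∀ x : H, x ∈ N → x ∈ Nᗮ → x = 0 := by
    intro x h1 h2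
    exact inner_self_eq_zero.mp ((Submodule.mem_orthogonal N x).mp h2 x h1)
  refine ⟨?_, ?_⟩
  · ext v
    constructor
    · rintro ⟨x, hx, hx₂, h⟩
      exact ⟨_, h⟩
    · rintro ⟨u, hu⟩
      obtain ⟨F, hF, hF₂, -, h⟩ := key2 v ⟨u, hu⟩
      exact ⟨F, hF, hF₂, h⟩
  · intro D PD hPD hperp
    refine ⟨key2 _ ?_, ?_⟩
    · rw [← hNR, ← neg_sub]
      exact Submodule.neg_mem _ ((Submodule.mem_orthogonal' N _).mpr hperp)
    · intro F₁ F₂ hF₁ hF₁₂ hF₂ hF₂₂ h1 h2 e1 e2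
      have hL : L ⟨F₁ - F₂, dom.sub_mem hF₁ hF₂⟩ = L ⟨F₁, hF₁⟩ - L ⟨F₂, hF₂⟩ := by
        rw [← map_sub]; rfl
      have hLL : L ⟨L ⟨F₁, hF₁⟩ - L ⟨F₂, hF₂⟩, dom.sub_mem hF₁₂ hF₂₂⟩ = 0 := by
        have : L ⟨L ⟨F₁, hF₁⟩ - L ⟨F₂, hF₂⟩, dom.sub_mem hF₁₂ hF₂₂⟩
            = L ⟨L ⟨F₁, hF₁⟩, hF₁₂⟩ - L ⟨L ⟨F₂, hF₂⟩, hF₂₂⟩ :=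
          map_sub L ⟨L ⟨F₁, hF₁⟩, hF₁₂⟩ ⟨L ⟨F₂, hF₂⟩, hF₂₂⟩
        rw [this, e1, e2, sub_self]
      have hz : L ⟨F₁, hF₁⟩ - L ⟨F₂, hF₂⟩ = 0 :=
        disj _ ((hN _).mpr ⟨_, hLL⟩) (by rw [hNR, ← hL]; exact ⟨_, rfl⟩)
      exact sub_eq_zero.mp (disj _ ((hN _).mpr ⟨_, hL.trans hz⟩) (Submodule.sub_mem _ h1 h2))
end

section
/- Let A : ℝ^m → M_m(ℝ) be a locally integrable matrix field such that A(y) is symmetric for a.e. y, and suppose that ∫_{ℝ^m} A(y) ∇_y u(y) · ∇_y v(y) dy = 0 for all u, v ∈ C¹_c(ℝ^m). Then A(y) = 0 for a.e. y ∈ ℝ^m. -/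
open MeasureTheory Matrix

lemma aux_integrable {m : ℕ}
    (A : (Fin m → ℝ) → Matrix (Fin m) (Fin m) ℝ)
    (hAloc : ∀ i j, LocallyIntegrable (fun y => A y i j) (volume : Measure (Fin m → ℝ)))
    (u v : (Fin m → ℝ) → ℝ)
    (hu : ContDiff ℝ 1 u) (hv : ContDiff ℝ 1 v) (hcv : HasCompactSupport v) :
    Integrable (fun y => (A y *ᵥ (fun i => fderiv ℝ u y (Pi.single i (1:ℝ)))) ⬝ᵥ
          (fun i => fderiv ℝ v y (Pi.single i (1:ℝ)))) (volume : Measure (Fin m → ℝ)) := by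
  simp only [dotProduct, mulVec, Finset.sum_mul]
  refine integrable_finsetSum _ fun i _ => integrable_finsetSum _ fun j _ => ?_
  have hc : Continuous (fun y => fderiv ℝ u y (Pi.single j (1:ℝ)) *
      fderiv ℝ v y (Pi.single i (1:ℝ))) :=
    ((hu.continuous_fderiv (by norm_num)).clm_apply continuous_const).mul
      ((hv.continuous_fderiv (by norm_num)).clm_apply continuous_const)
  have hs : HasCompactSupport (fun y => fderiv ℝ u y (Pi.single j (1:ℝ)) *
      fderiv ℝ v y (Pi.single i (1:ℝ))) :=
    HasCompactSupport.mul_left (hcv.fderiv_apply (𝕜 := ℝ) _)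
  have := (hAloc i j).integrable_smul_left_of_hasCompactSupport hc hs
  refine this.congr (Filter.Eventually.of_forall fun y => ?_)
  simp only [smul_eq_mul]
  ring

theorem symmetric_matrix_field_vanishes_of_weak_orthogonality
    (m : ℕ) (hm : 1 ≤ m)
    (A : (Fin m → ℝ) → Matrix (Fin m) (Fin m) ℝ)
    (hAloc : ∀ i j, LocallyIntegrable (fun y => A y i j) (volume : Measure (Fin m → ℝ)))
    (hAsym : ∀ᵐ y ∂(volume : Measure (Fin m → ℝ)), (A y)ᵀ = A y)
    (h : ∀ u v : (Fin m → ℝ) → ℝ,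
      ContDiff ℝ 1 u → HasCompactSupport u → ContDiff ℝ 1 v → HasCompactSupport v →
      ∫ y, (A y *ᵥ (fun i => fderiv ℝ u y (Pi.single i (1:ℝ)))) ⬝ᵥ
          (fun i => fderiv ℝ v y (Pi.single i (1:ℝ)))
          ∂(volume : Measure (Fin m → ℝ)) = 0) :
    ∀ᵐ y ∂(volume : Measure (Fin m → ℝ)), A y = 0 := by
  have key : ∀ i j, ∀ᵐ y ∂(volume : Measure (Fin m → ℝ)), A y i j = 0 := by
    intro i j
    refine ae_eq_zero_of_integral_contDiff_smul_eq_zero (hAloc i j) ?_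
    intro p hp' hpc
    have hp : ContDiff ℝ 1 p := hp'.of_le (by exact_mod_cast le_top)
    obtain ⟨R, hR⟩ := hpc.isCompact.isBounded.subset_closedBall (0 : Fin m → ℝ)
    let χ : ContDiffBump (0 : Fin m → ℝ) := ⟨|R| + 1, |R| + 2, by positivity, by linarith⟩
    have hχ : ContDiff ℝ 1 χ := χ.contDiff
    have hχc : HasCompactSupport χ := χ.hasCompactSupport
    set f : (Fin m → ℝ) → ℝ := fun y => χ y * y j with hf
    set g : (Fin m → ℝ) → ℝ := fun y => χ y * y i with hg
    have cf : ContDiff ℝ 1 f := hχ.mul (contDiff_apply ℝ ℝ j)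
    have cg : ContDiff ℝ 1 g := hχ.mul (contDiff_apply ℝ ℝ i)
    have sf : HasCompactSupport f := hχc.mul_right
    have sg : HasCompactSupport g := hχc.mul_right
    have loc : ∀ (k : Fin m) (y : Fin m → ℝ), p y ≠ 0 →
        fderiv ℝ (fun y => χ y * y k) y = ContinuousLinearMap.proj k := by
      intro k y hy
      have h1 : y ∈ Metric.closedBall (0 : Fin m → ℝ) R := hR (subset_tsupport _ hy)
      have h2 : y ∈ Metric.ball (0 : Fin m → ℝ) χ.rIn := by
        rw [Metric.mem_ball]
        rw [Metric.mem_closedBall] at h1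
        have : χ.rIn = |R| + 1 := rfl
        have := le_abs_self R
        linarith
      have h3 : (fun y => χ y * y k) =ᶠ[nhds y] (fun y => y k) := by
        filter_upwards [Metric.isOpen_ball.mem_nhds h2] with z hz
        rw [χ.one_of_mem_closedBall (Metric.ball_subset_closedBall hz), one_mul]
      rw [h3.fderiv_eq]
      exact (ContinuousLinearMap.proj (R := ℝ) (φ := fun _ : Fin m => ℝ) k).fderiv
    have i1 := aux_integrable A hAloc (fun y => p y * f y) g (hp.mul cf) cg sg
    have i2 := aux_integrable A hAloc (fun y => p y * g y) f (hp.mul cg) cf sf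
    have i3 := aux_integrable A hAloc (fun y => f y * g y) p (cf.mul cg) hp hpc
    have e1 := h (fun y => p y * f y) g (hp.mul cf) hpc.mul_right cg sg
    have e2 := h (fun y => p y * g y) f (hp.mul cg) hpc.mul_right cf sf
    have e3 := h (fun y => f y * g y) p (cf.mul cg) sf.mul_right hp hpc
    have e4 := integral_sub (i1.add i2) i3
    have e5 := integral_add i1 i2
    simp only [Pi.add_apply] at e4
    rw [e5, e1, e2, e3] at e4
    have e6 : ∫ y, 2 * (p y • A y i j) = 0 := by
      rw [show (0:ℝ) = 0 + 0 - 0 by norm_num, ← e4]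
      refine integral_congr_ae ?_
      filter_upwards [hAsym] with y hy
      have dp := (hp.differentiable (by norm_num)) y
      have df := (cf.differentiable (by norm_num)) y
      have dg := (cg.differentiable (by norm_num)) y
      have D : ∀ a b : (Fin m → ℝ) → ℝ, DifferentiableAt ℝ a y → DifferentiableAt ℝ b y →
          (fun k => fderiv ℝ (fun y => a y * b y) y (Pi.single k (1:ℝ))) =
          a y • (fun k => fderiv ℝ b y (Pi.single k (1:ℝ))) +
          b y • (fun k => fderiv ℝ a y (Pi.single k (1:ℝ))) := by
        intro a b ha hb
        ext k
        rw [fderiv_fun_mul ha hb]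
        simp
      have S : ∀ a b : Fin m → ℝ, (A y *ᵥ a) ⬝ᵥ b = (A y *ᵥ b) ⬝ᵥ a := by
        intro a b
        rw [dotProduct_comm, dotProduct_mulVec, ← mulVec_transpose, hy]
      rw [D p f dp df, D p g dp dg, D f g df dg]
      simp only [mulVec_add, mulVec_smul, add_dotProduct, smul_dotProduct, smul_eq_mul]
      rw [S (fun k => fderiv ℝ g y (Pi.single k (1:ℝ))) (fun k => fderiv ℝ f y (Pi.single k (1:ℝ))),
        S (fun k => fderiv ℝ g y (Pi.single k (1:ℝ))) (fun k => fderiv ℝ p y (Pi.single k (1:ℝ))),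
        S (fun k => fderiv ℝ f y (Pi.single k (1:ℝ))) (fun k => fderiv ℝ p y (Pi.single k (1:ℝ)))]
      have F : p y * A y i j = p y * ((A y *ᵥ fun k => fderiv ℝ f y (Pi.single k (1:ℝ))) ⬝ᵥ
          fun k => fderiv ℝ g y (Pi.single k (1:ℝ))) := by
        by_cases h0 : p y = 0
        · simp [h0]
        · rw [hf, hg, loc j y h0, loc i y h0]
          simp [dotProduct, mulVec, Pi.single_apply]
      linear_combination 2 * F
    rw [integral_const_mul] at e6
    linarith
  have := ae_all_iff.2 fun i => ae_all_iff.2 fun j => key i j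
  filter_upwards [this] with y hy
  ext i j
  exact hy i j
end
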